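/- arXiv:0709.0517 — 5 statements merged into one kernel-verified Lean document; each statement's English description precedes it below -/
import Mathlib

section
/- (Donoho–Stark) Let n be a positive integer and T, Ω ⊆ {1,…,n}. If |T|·|Ω| < n, then ‖F_{ΩT}‖ < 1. (Indeed, ‖F_{ΩT}‖² ≤ |Ω||T|/n, since the entries of F are bounded in magnitude by n^{-1/2} and the Frobenius norm dominates the spectral norm.) -/
/-- The spectral norm (ℓ2 → ℓ2 operator norm) of a complex matrix. -/
noncomputable def specNorm {α β : Type*} [Fintype α] [Fintype β] [DecidableEq β]
    (A : Matrix α β ℂ) : ℝ :=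
  ‖LinearMap.toContinuousLinearMap (Matrix.toEuclideanLin A)‖

/-- The `n × n` discrete Fourier transform matrix, with entries
`F (j, t) = n^{-1/2} e^{2πi j t / n}` for `j, t = 1, …, n` (indices coded by `Fin n` via
`j ↦ j.val + 1`). -/
noncomputable def dftMatrix (n : ℕ) : Matrix (Fin n) (Fin n) ℂ := fun j t =>
  (1 / (Real.sqrt n : ℂ)) *
    Complex.exp (2 * Real.pi * Complex.I * (((j : ℕ) : ℂ) + 1) * (((t : ℕ) : ℂ) + 1) / (n : ℂ))

/-- The submatrix `F_{ΩT}` of the DFT matrix with rows indexed by `Ω` and columns by `T`. -/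
noncomputable def dftSub (n : ℕ) (Ω T : Finset (Fin n)) : Matrix Ω T ℂ :=
  (dftMatrix n).submatrix (fun ω => (ω : Fin n)) (fun t => (t : Fin n))

/-- The spectral norm is dominated by the Frobenius norm. -/
theorem specNorm_sq_le_sum_norm_sq {α β : Type*} [Fintype α] [Fintype β] [DecidableEq β]
    (A : Matrix α β ℂ) : specNorm A ^ 2 ≤ ∑ i, ∑ j, ‖A i j‖ ^ 2 := by
  have hS : 0 ≤ ∑ i, ∑ j, ‖A i j‖ ^ 2 := by positivity
  rw [specNorm, ← Real.le_sqrt (norm_nonneg _) hS]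
  refine ContinuousLinearMap.opNorm_le_bound _ (Real.sqrt_nonneg _) fun x => ?_
  rw [← sq_le_sq₀ (norm_nonneg _) (by positivity), mul_pow, Real.sq_sqrt hS,
    EuclideanSpace.norm_sq_eq, EuclideanSpace.norm_sq_eq, Finset.sum_mul]
  refine Finset.sum_le_sum fun i _ => ?_
  have hi : ‖(Matrix.toEuclideanLin A x) i‖ ≤ ∑ j, ‖A i j‖ * ‖x j‖ := by
    simp only [Matrix.toLpLin_apply, Matrix.mulVec, dotProduct]
    exact (norm_sum_le _ _).trans_eq (by simp only [norm_mul])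
  calc ‖(Matrix.toEuclideanLin A x) i‖ ^ 2 ≤ (∑ j, ‖A i j‖ * ‖x j‖) ^ 2 := by gcongr
    _ ≤ (∑ j, ‖A i j‖ ^ 2) * ∑ j, ‖x j‖ ^ 2 := Finset.sum_mul_sq_le_sq_mul_sq _ _ _

/-- Every entry of the DFT matrix has squared modulus `1 / n`. -/
theorem norm_dftMatrix_sq (n : ℕ) (j t : Fin n) : ‖dftMatrix n j t‖ ^ 2 = 1 / n := by
  have harg : 2 * Real.pi * Complex.I * (((j : ℕ) : ℂ) + 1) * (((t : ℕ) : ℂ) + 1) / (n : ℂ)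
      = ((2 * Real.pi * ((j : ℕ) + 1) * ((t : ℕ) + 1) / n : ℝ) : ℂ) * Complex.I := by
    push_cast
    ring
  rw [dftMatrix, harg, norm_mul, Complex.norm_exp_ofReal_mul_I, mul_one, norm_div, norm_one,
    Complex.norm_real, Real.norm_of_nonneg (Real.sqrt_nonneg _), div_pow, one_pow,
    Real.sq_sqrt n.cast_nonneg]

/-- **Donoho–Stark.** If `|T|·|Ω| < n`, then `‖F_{ΩT}‖² ≤ |Ω||T|/n` and `‖F_{ΩT}‖ < 1`. -/
theorem stmt_2 (n : ℕ) (hn : 0 < n) (T Ω : Finset (Fin n))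
    (h : T.card * Ω.card < n) :
    specNorm (dftSub n Ω T) ^ 2 ≤ (Ω.card * T.card : ℝ) / n ∧
      specNorm (dftSub n Ω T) < 1 := by
  have hsq : specNorm (dftSub n Ω T) ^ 2 ≤ (Ω.card * T.card : ℝ) / n := by
    refine (specNorm_sq_le_sum_norm_sq _).trans_eq ?_
    simp only [dftSub, Matrix.submatrix_apply, norm_dftMatrix_sq, Finset.sum_const,
      Finset.card_univ, Fintype.card_coe, nsmul_eq_mul]
    ring
  refine ⟨hsq, ?_⟩
  have hlt : (Ω.card * T.card : ℝ) / n < 1 := by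
    rw [div_lt_one (by exact_mod_cast hn), mul_comm]
    exact_mod_cast h
  exact lt_of_pow_lt_pow_left₀ 2 zero_le_one (by simpa using hsq.trans_lt hlt)
end

section
/- (Donoho–Stark, additive form) Let n be a positive integer and T, Ω ⊆ {1,…,n}. If |T| + |Ω| < 2√n, then ‖F_{ΩT}‖ < 1. -/
theorem norm_dftMatrix_apply (n : ℕ) (j t : Fin n) : ‖dftMatrix n j t‖ = 1 / Real.sqrt n := by
  have harg : 2 * Real.pi * Complex.I * (((j : ℕ) : ℂ) + 1) * (((t : ℕ) : ℂ) + 1) / (n : ℂ) =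
      ((2 * Real.pi * ((j : ℕ) + 1) * ((t : ℕ) + 1) / n : ℝ) : ℂ) * Complex.I := by
    push_cast
    ring
  rw [dftMatrix, harg, norm_mul, Complex.norm_exp_ofReal_mul_I, mul_one, norm_div, norm_one,
    Complex.norm_real, Real.norm_of_nonneg (Real.sqrt_nonneg _)]

/-- A matrix with entries bounded by `c` has spectral norm at most `c` times the square root of
its number of entries. -/
theorem specNorm_le_of_entry_bound {α β : Type*} [Fintype α] [Fintype β] [DecidableEq β]
    (A : Matrix α β ℂ) {c : ℝ} (hc : 0 ≤ c) (hA : ∀ i j, ‖A i j‖ ≤ c) :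
    specNorm A ≤ c * Real.sqrt (Fintype.card α * Fintype.card β) := by
  refine ContinuousLinearMap.opNorm_le_bound _ (by positivity) fun x => ?_
  refine le_of_sq_le_sq ?_ (by positivity)
  rw [mul_pow, mul_pow, Real.sq_sqrt (by positivity), EuclideanSpace.norm_sq_eq,
    EuclideanSpace.norm_sq_eq]
  have hrow (i : α) : ‖(Matrix.toEuclideanLin A x) i‖ ^ 2 ≤
      c ^ 2 * (Fintype.card β * ∑ j, ‖x j‖ ^ 2) := by
    have hle : ‖(Matrix.toEuclideanLin A x) i‖ ≤ c * ∑ j, ‖x j‖ := by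
      rw [Finset.mul_sum]
      refine (norm_sum_le _ _).trans (Finset.sum_le_sum fun j _ => ?_)
      rw [norm_mul]
      exact mul_le_mul_of_nonneg_right (hA i j) (norm_nonneg _)
    calc ‖(Matrix.toEuclideanLin A x) i‖ ^ 2 ≤ (c * ∑ j, ‖x j‖) ^ 2 := by gcongr
      _ = c ^ 2 * (∑ j, ‖x j‖) ^ 2 := mul_pow _ _ _
      _ ≤ _ := by
        gcongr
        exact sq_sum_le_card_mul_sum_sq
  calc _ ≤ ∑ _i : α, c ^ 2 * (Fintype.card β * ∑ j, ‖x j‖ ^ 2) :=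
        Finset.sum_le_sum fun i _ => hrow i
    _ = _ := by
      rw [Finset.sum_const, Finset.card_univ, nsmul_eq_mul]
      ring

/-- **Donoho–Stark, additive form.** If `|T| + |Ω| < 2√n`, then `‖F_{ΩT}‖ < 1`. -/
theorem stmt_3 (n : ℕ) (hn : 0 < n) (T Ω : Finset (Fin n))
    (h : (T.card + Ω.card : ℝ) < 2 * Real.sqrt n) :
    specNorm (dftSub n Ω T) < 1 := by
  have hn' : (0 : ℝ) < n := by exact_mod_cast hn
  have hs : 0 < Real.sqrt n := Real.sqrt_pos.mpr hn'
  have hle := specNorm_le_of_entry_bound (dftSub n Ω T) (c := 1 / Real.sqrt n) (by positivity)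
    fun i j => (norm_dftMatrix_apply n i j).le
  refine hle.trans_lt ?_
  rw [one_div_mul_eq_div, div_lt_one hs, Fintype.card_coe, Fintype.card_coe]
  refine Real.sqrt_lt_sqrt (by positivity) ?_
  have hsq : (T.card + Ω.card : ℝ) ^ 2 < (2 * Real.sqrt n) ^ 2 := by gcongr
  rw [mul_pow, Real.sq_sqrt hn'.le] at hsq
  nlinarith [sq_nonneg ((T.card : ℝ) - Ω.card)]
end

section
/- (Tao) Suppose n is a prime number and T, Ω ⊆ {1,…,n} satisfy |T| + |Ω| ≤ n. Then ‖F_{ΩT}‖ < 1. -/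
open Polynomial in
/-- A combination of the powers `X ^ e i`, `i ∈ s`, whose exponents are distinct in the field `k`,
is divisible by `(X - 1) ^ #s` only if it is trivial. -/
theorem eq_zero_of_X_sub_one_pow_dvd {ι k : Type*} [Field k] (e : ι → ℕ) (s : Finset ι)
    (he : Set.InjOn (fun i => (e i : k)) s) (c : ι → k)
    (h : (X - 1 : k[X]) ^ s.card ∣ ∑ i ∈ s, C (c i) * X ^ e i) : ∀ i ∈ s, c i = 0 := by
  classical
  induction s using Finset.induction_on generalizing c with
  | empty => simp
  | insert a s ha ih =>
    rw [Finset.card_insert_of_notMem ha] at h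
    have hs : ∀ i ∈ s, c i = 0 := by
      have hd : (X - 1 : k[X]) ^ s.card ∣ ∑ i ∈ s, C (((e i : k) - e a) * c i) * X ^ e i := by
        have h1 := (pow_sub_one_dvd_derivative_of_pow_dvd h).mul_left X
        have h2 := ((pow_dvd_pow _ (Nat.le_succ _)).trans h).mul_left (C (e a : k))
        have hX : ∀ i, X * derivative (C (c i) * X ^ e i) - C (e a : k) * (C (c i) * X ^ e i)
            = C (((e i : k) - e a) * c i) * X ^ e i := by
          intro i
          rw [derivative_C_mul_X_pow]
          rcases Nat.eq_zero_or_pos (e i) with h0 | h0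
          · simp [h0]
          · obtain ⟨m, hm⟩ := Nat.exists_eq_succ_of_ne_zero h0.ne'
            simp only [hm, Nat.succ_eq_add_one, Nat.add_sub_cancel, C_mul, C_sub]
            ring
        convert dvd_sub h1 h2 using 1
        · simp
        · rw [derivative_sum, Finset.mul_sum, Finset.mul_sum, ← Finset.sum_sub_distrib,
            Finset.sum_congr rfl fun i _ => hX i, Finset.sum_insert ha]
          simp
      intro i hi
      have := ih (he.mono (by simp)) _ hd i hi
      refine (mul_eq_zero.1 this).resolve_left fun h0 => ha ?_
      have := he (by simp [hi]) (by simp) (sub_eq_zero.1 h0)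
      exact this ▸ hi
    intro i hi
    rcases Finset.mem_insert.1 hi with rfl | hi
    · rw [Finset.sum_insert ha, Finset.sum_eq_zero fun j hj => by simp [hs j hj], add_zero] at h
      obtain ⟨q, hq⟩ := (dvd_pow_self _ (Nat.succ_ne_zero _)).trans h
      simpa using congrArg (eval 1) hq
    · exact hs i hi

/-- Every field of characteristic zero has a valuation subring in which the prime `p` is not
invertible. -/
theorem exists_valuationSubring_natCast_mem_nonunits (K : Type*) [Field K] [CharZero K] {p : ℕ}
    (hp : p.Prime) : ∃ V : ValuationSubring K, (p : K) ∈ V.nonunits := by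
  let f : ℤ →+* K := Int.castRingHom K
  have hI : Ideal.span {(p : f.range)} ≠ ⊤ := by
    rw [Ne, Ideal.span_singleton_eq_top, isUnit_iff_exists_inv]
    rintro ⟨⟨_, b, rfl⟩, hb⟩
    have hb' : ((p * b : ℤ) : K) = (1 : ℤ) := by simpa [f] using congrArg Subtype.val hb
    have h1 : IsUnit (p : ℤ) := IsUnit.of_mul_eq_one _ (Int.cast_injective hb')
    exact (Nat.prime_iff_prime_int.1 hp).not_isUnit h1
  obtain ⟨V, -, hV⟩ := Ideal.image_subset_nonunits_valuationSubring _ hI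
  exact ⟨V, hV ⟨_, Ideal.subset_span rfl, by simp⟩⟩

open Polynomial in
/-- **Chebotarev's theorem on roots of unity**: for `p` prime, a combination of the powers
`x ^ e i`, `i ∈ s`, with exponents distinct mod `p`, that vanishes at `#s` distinct `p`-th roots
of unity is trivial. -/
theorem eq_zero_of_sum_mul_pow_eq_zero {ι K : Type*} [Field K] [CharZero K] {p : ℕ}
    (hp : p.Prime) (e : ι → ℕ) (s : Finset ι) (he : Set.InjOn (fun i => (e i : ZMod p)) s)
    (c : ι → K) (J : Finset K) (hJ : ∀ x ∈ J, x ^ p = 1) (hcard : s.card ≤ J.card)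
    (h : ∀ x ∈ J, ∑ i ∈ s, c i * x ^ e i = 0) : ∀ i ∈ s, c i = 0 := by
  classical
  obtain ⟨V, hV⟩ := exists_valuationSubring_natCast_mem_nonunits K hp
  have : Fact p.Prime := ⟨hp⟩
  let k := IsLocalRing.ResidueField V
  let r : V →+* k := IsLocalRing.residue V
  have : CharP k p := by
    obtain ⟨q, hq⟩ := CharP.exists k
    suffices hqp : q ∣ p by
      rcases (Nat.dvd_prime hp).1 hqp with rfl | rfl
      · exact absurd rfl (CharP.char_ne_one k 1)
      · exact hq
    rw [← CharP.cast_eq_zero_iff k q p]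
    have : r (p : V) = 0 := by
      rw [IsLocalRing.residue_eq_zero_iff]
      rw [← SetLike.mem_coe, ← V.image_maximalIdeal] at hV
      obtain ⟨y, hy, hyp⟩ := hV
      rwa [show (p : V) = y from Subtype.ext (by simpa using hyp.symm)]
    simpa using this
  by_contra! hne
  obtain ⟨i₀, hi₀, hc₀⟩ := hne
  obtain ⟨m, hm, hmax⟩ := s.exists_max_image (fun i => V.valuation (c i)) ⟨i₀, hi₀⟩
  have hcm : c m ≠ 0 := by
    intro h0
    have := hmax i₀ hi₀
    simp only [h0, map_zero, le_zero_iff, map_eq_zero] at this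
    exact hc₀ this
  have hmem : ∀ i ∈ s, c i / c m ∈ V := by
    intro i hi
    rw [← V.valuation_le_one_iff, map_div₀]
    exact div_le_one_of_le₀ (hmax i hi) zero_le
  let d : ι → V := fun i => if hi : c i / c m ∈ V then ⟨c i / c m, hi⟩ else 0
  have hd : ∀ i ∈ s, (d i : K) = c i / c m := fun i hi => by simp [d, hmem i hi]
  have hJV : ∀ x ∈ J, x ∈ V := by
    intro x hx
    rw [← V.valuation_le_one_iff]
    refine (pow_le_one_iff hp.ne_zero).1 (le_of_eq ?_)
    rw [← map_pow, hJ x hx, map_one]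
  let J' : Finset V := J.subtype (· ∈ V)
  have hJ'card : J'.card = J.card := by
    rw [Finset.card_subtype, Finset.filter_true_of_mem hJV]
  let P : V[X] := ∑ i ∈ s, C (d i) * X ^ e i
  have hroot : ∀ x ∈ J', P.IsRoot x := by
    intro x hx
    have hx' : (x : K) ∈ J := by simpa [J'] using hx
    refine Subtype.ext ?_
    have h1 : ∑ i ∈ s, (d i : K) * (x : K) ^ e i = 0 := by
      rw [Finset.sum_congr rfl fun i hi => by rw [hd i hi, div_mul_eq_mul_div],
        ← Finset.sum_div, h x hx', zero_div]
    simpa [P, eval_finsetSum] using h1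
  have hdvd : (∏ x ∈ J', (X - C x)) ∣ P := by
    by_cases hP : P = 0
    · simp [hP]
    · refine (Multiset.prod_X_sub_C_dvd_iff_le_roots hP J'.val).2 ?_
      exact (Multiset.le_iff_subset J'.nodup).2 fun x hx => (mem_roots hP).2 (hroot x hx)
  have hres : ∀ x ∈ J', r x = 1 := by
    intro x hx
    have hx' : (x : K) ∈ J := by simpa [J'] using hx
    have h1 : x ^ p = 1 := Subtype.ext (by simpa using hJ _ hx')
    have h2 : (r x - 1) ^ p = 0 := by
      rw [sub_pow_char, ← map_pow, h1, map_one, one_pow, sub_self]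
    exact sub_eq_zero.1 (eq_zero_of_pow_eq_zero h2)
  have hdvd' : (X - 1 : k[X]) ^ s.card ∣ ∑ i ∈ s, C (r (d i)) * X ^ e i := by
    have h1 := Polynomial.map_dvd r hdvd
    rw [Polynomial.map_prod, Finset.prod_congr rfl (g := fun _ => (X - 1 : k[X]))
      (fun x hx => by simp [hres x hx]), Finset.prod_const, hJ'card] at h1
    simpa [P, Polynomial.map_sum] using (pow_dvd_pow _ hcard).trans h1
  have he' : Set.InjOn (fun i => (e i : k)) s := by
    intro i hi j hj hij
    refine he hi hj ?_
    simp only at hij ⊢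
    rwa [ZMod.natCast_eq_natCast_iff, ← CharP.natCast_eq_natCast k p]
  have h0 := eq_zero_of_X_sub_one_pow_dvd e s he' _ hdvd' m hm
  have h1 : d m = 1 := Subtype.ext (by simp [hd m hm, hcm])
  simp [h1] at h0

/-- A linear map on a finite-dimensional space that strictly decreases the norm of every nonzero
vector has operator norm less than one. -/
theorem ContinuousLinearMap.norm_lt_one_of_forall_norm_apply_lt {𝕜 E F : Type*} [RCLike 𝕜]
    [NormedAddCommGroup E] [NormedSpace 𝕜 E] [FiniteDimensional 𝕜 E]
    [SeminormedAddCommGroup F] [NormedSpace 𝕜 F] (f : E →L[𝕜] F)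
    (h : ∀ x ≠ 0, ‖f x‖ < ‖x‖) : ‖f‖ < 1 := by
  have := FiniteDimensional.proper_rclike 𝕜 E
  obtain ⟨x, hx, hmax⟩ := (isCompact_closedBall (0 : E) 1).exists_isMaxOn
    ⟨0, by simp⟩ (f.continuous.norm.continuousOn)
  refine lt_of_le_of_lt (b := ‖f x‖) ?_ ?_
  · let : NormedSpace ℝ E := NormedSpace.restrictScalars ℝ 𝕜 E
    exact f.opNorm_le_of_unit_norm (norm_nonneg _) fun y hy => hmax (by simp [hy])
  · rcases eq_or_ne x 0 with rfl | h0
    · simp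
    · exact (h x h0).trans_le (by simpa using hx)

/-- The entries of the DFT matrix as powers of a primitive root of unity. -/
theorem dftMatrix_apply_eq_pow (n : ℕ) (j t : Fin n) :
    dftMatrix n j t = (1 / (Real.sqrt n : ℂ)) *
      (Complex.exp (2 * Real.pi * Complex.I / n) ^ (j.val + 1)) ^ (t.val + 1) := by
  rw [dftMatrix, ← pow_mul, ← Complex.exp_nat_mul]
  congr 2
  push_cast
  ring

/-- The DFT matrix is unitary. -/
theorem conjTranspose_dftMatrix_mul_self {n : ℕ} (hn : n ≠ 0) :
    (dftMatrix n).conjTranspose * dftMatrix n = 1 := by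
  have hζ := Complex.isPrimitiveRoot_exp n hn
  have hnorm := hζ.norm'_eq_one hn
  ext s t
  rw [Matrix.mul_apply, Matrix.one_apply]
  simp only [Matrix.conjTranspose_apply, dftMatrix_apply_eq_pow]
  set ζ := Complex.exp (2 * Real.pi * Complex.I / n) with hζdef
  have hn' : (n : ℂ) ≠ 0 := Nat.cast_ne_zero.2 hn
  have hζ0 : ζ ≠ 0 := Complex.exp_ne_zero _
  have hstar : star ζ = ζ⁻¹ := (Complex.inv_eq_conj hnorm).symm
  have hsqrt : (Real.sqrt n : ℂ) * (Real.sqrt n : ℂ) = n := by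
    rw [← Complex.ofReal_mul, Real.mul_self_sqrt (Nat.cast_nonneg n), Complex.ofReal_natCast]
  let w : ℂ := ζ ^ (t.val + 1) * ζ⁻¹ ^ (s.val + 1)
  have hterm : ∀ j : Fin n,
      star (1 / (Real.sqrt n : ℂ) * (ζ ^ (j.val + 1)) ^ (s.val + 1)) *
        (1 / (Real.sqrt n : ℂ) * (ζ ^ (j.val + 1)) ^ (t.val + 1)) = 1 / n * w * w ^ j.val := by
    intro j
    have h1 : star (1 / (Real.sqrt n : ℂ)) = 1 / (Real.sqrt n : ℂ) := by simp
    rw [star_mul', star_pow, star_pow, hstar, h1, ← hsqrt]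
    simp only [w]
    ring
  rw [Finset.sum_congr rfl fun j _ => hterm j, ← Finset.mul_sum,
    Fin.sum_univ_eq_sum_range fun j => w ^ j]
  split_ifs with hst
  · have hw : w = 1 := by simp [w, hst, hζ0]
    simp [hw, hn']
  · have hw : w ≠ 1 := by
      intro hw
      simp only [w, inv_pow] at hw
      have h2 : ζ ^ t.val = ζ ^ s.val :=
        mul_right_cancel₀ hζ0 (by simpa [pow_succ] using eq_of_mul_inv_eq_one hw)
      exact hst (Fin.ext (hζ.pow_inj t.2 s.2 h2).symm)
    have hwn : w ^ n = 1 := by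
      simp only [w, mul_pow, ← pow_mul, mul_comm _ n, inv_pow]
      simp [pow_mul, hζ.pow_eq_one]
    rw [geom_sum_eq hw, hwn]
    simp

/-- Parseval's identity for the DFT matrix. -/
theorem sum_norm_dftMatrix_mulVec_sq {n : ℕ} (hn : n ≠ 0) (v : Fin n → ℂ) :
    ∑ j, ‖(dftMatrix n).mulVec v j‖ ^ 2 = ∑ t, ‖v t‖ ^ 2 := by
  have key : star ((dftMatrix n).mulVec v) ⬝ᵥ (dftMatrix n).mulVec v = star v ⬝ᵥ v := by
    rw [Matrix.star_mulVec, ← Matrix.dotProduct_mulVec, Matrix.mulVec_mulVec,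
      conjTranspose_dftMatrix_mul_self hn, Matrix.one_mulVec]
  simp only [dotProduct, Pi.star_apply, Complex.star_def, Complex.conj_mul'] at key
  exact_mod_cast key

/-- The uncertainty principle for `ℤ/nℤ`, `n` prime: a vector supported on `T` whose discrete
Fourier transform is supported on `Ω` is zero if `#T + #Ω ≤ n`. -/
theorem eq_zero_of_dftMatrix_mulVec_eq_zero {n : ℕ} (hp : n.Prime) (T Ω : Finset (Fin n))
    (h : T.card + Ω.card ≤ n) (v : Fin n → ℂ) (hT : ∀ t ∉ T, v t = 0)
    (hΩ : ∀ j ∉ Ω, (dftMatrix n).mulVec v j = 0) : v = 0 := by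
  have hζ := Complex.isPrimitiveRoot_exp n hp.ne_zero
  set ζ := Complex.exp (2 * Real.pi * Complex.I / n) with hζdef
  have hζ0 : ζ ≠ 0 := Complex.exp_ne_zero _
  have hinj : Function.Injective fun j : Fin n => ζ ^ (j.val + 1) := by
    intro i j hij
    simp only [pow_succ] at hij
    exact Fin.ext (hζ.pow_inj i.2 j.2 (mul_right_cancel₀ hζ0 hij))
  have hexp : Set.InjOn (fun t : Fin n => ((t.val + 1 : ℕ) : ZMod n)) T := by
    intro s _ t _ hst
    simp only [ZMod.natCast_eq_natCast_iff] at hst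
    exact Fin.ext ((Nat.ModEq.add_right_cancel' 1 hst).eq_of_lt_of_lt s.2 t.2)
  have hzero := eq_zero_of_sum_mul_pow_eq_zero hp (fun t : Fin n => t.val + 1) T hexp v
    (Ωᶜ.image fun j : Fin n => ζ ^ (j.val + 1)) ?_ ?_ ?_
  · funext t
    by_cases ht : t ∈ T
    · exact hzero t ht
    · exact hT t ht
  · simp only [Finset.mem_image]
    rintro _ ⟨j, -, rfl⟩
    rw [pow_right_comm, hζ.pow_eq_one, one_pow]
  · rw [Finset.card_image_of_injective _ hinj, Finset.card_compl, Fintype.card_fin]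
    omega
  · simp only [Finset.mem_image, Finset.mem_compl]
    rintro _ ⟨j, hj, rfl⟩
    have h1 := hΩ j hj
    simp only [Matrix.mulVec, dotProduct, dftMatrix_apply_eq_pow, ← hζdef,
      mul_assoc (1 / (Real.sqrt n : ℂ))] at h1
    rw [← Finset.mul_sum] at h1
    have hsqrt : (1 / (Real.sqrt n : ℂ)) ≠ 0 := by simp [hp.ne_zero]
    rw [← (mul_eq_zero.1 h1).resolve_left hsqrt,
      ← Finset.sum_subset T.subset_univ fun t _ ht => by simp [hT t ht]]
    exact Finset.sum_congr rfl fun t _ => mul_comm _ _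

/-- **Tao.** If `n` is prime and `|T| + |Ω| ≤ n`, then `‖F_{ΩT}‖ < 1`. -/
theorem stmt_6 (n : ℕ) (hp : Nat.Prime n) (T Ω : Finset (Fin n))
    (h : T.card + Ω.card ≤ n) :
    specNorm (dftSub n Ω T) < 1 := by
  refine ContinuousLinearMap.norm_lt_one_of_forall_norm_apply_lt _ fun x hx => ?_
  let v : Fin n → ℂ := fun t => if ht : t ∈ T then x ⟨t, ht⟩ else 0
  have hvT : ∀ t ∉ T, v t = 0 := fun t ht => by simp [v, ht]
  have hvx : ∀ t : T, v t = x t := fun t => by simp [v]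
  have hsub : ∀ j : Ω, Matrix.toEuclideanLin (dftSub n Ω T) x j = (dftMatrix n).mulVec v j := by
    intro j
    simp only [Matrix.toLpLin_apply, Matrix.mulVec, dotProduct, dftSub, Matrix.submatrix_apply]
    rw [← Finset.sum_subset T.subset_univ fun t _ ht => by simp [hvT t ht], ← Finset.sum_coe_sort T]
    exact Finset.sum_congr rfl fun t _ => by rw [hvx]
  have hnorm_x : ‖x‖ ^ 2 = ∑ t, ‖v t‖ ^ 2 := by
    rw [EuclideanSpace.norm_sq_eq,
      ← Finset.sum_subset T.subset_univ fun t _ ht => by simp [hvT t ht], ← Finset.sum_coe_sort T]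
    exact Finset.sum_congr rfl fun t _ => by rw [hvx]
  obtain ⟨j, hj, hne⟩ : ∃ j ∉ Ω, (dftMatrix n).mulVec v j ≠ 0 := by
    by_contra! hΩ
    have hv := eq_zero_of_dftMatrix_mulVec_eq_zero hp T Ω h v hvT hΩ
    refine hx (PiLp.ext fun t => ?_)
    rw [← hvx, hv]
    rfl
  refine lt_of_pow_lt_pow_left₀ 2 (norm_nonneg x) ?_
  rw [LinearMap.coe_toContinuousLinearMap', hnorm_x, ← sum_norm_dftMatrix_mulVec_sq hp.ne_zero,
    EuclideanSpace.norm_sq_eq, Finset.sum_congr rfl fun j _ => by rw [hsub j],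
    Finset.sum_coe_sort Ω fun j => ‖(dftMatrix n).mulVec v j‖ ^ 2]
  exact Finset.sum_lt_sum_of_subset Ω.subset_univ (Finset.mem_univ j) hj (by positivity)
    fun _ _ _ => by positivity
end

section
/- (Large sieve inequality) Let n be a positive integer. Suppose T = {m+1, m+2, …, m+|T|} is a block of adjacent indices in {1,…,n} (for some integer m), and let Ω ⊆ {1,…,n} with |Ω| ≥ 2. Then ‖F_{ΩT}‖² ≤ (|T| + n/spread(Ω) − 1)/n. In particular, if |T| + n/spread(Ω) < n + 1, then ‖F_{ΩT}‖ < 1. -/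
/-- The circular distance `|j − k mod n|`, where the modulus returns values in the symmetric
range `{−⌈n/2⌉+1, …, ⌊n/2⌋}` (indices coded by `Fin n` via `j ↦ j.val + 1`; the distance is
unaffected by the shift). -/
def circDist (n : ℕ) (j k : Fin n) : ℕ :=
  min (((j : ℕ) + n - (k : ℕ)) % n) (((k : ℕ) + n - (j : ℕ)) % n)

/-- The spread of a set `Ω`: the minimum of `|j − k mod n|` over distinct pairs `j, k ∈ Ω`. -/
noncomputable def spread (n : ℕ) (Ω : Finset (Fin n)) : ℕ :=
  sInf {d | ∃ j ∈ Ω, ∃ k ∈ Ω, j ≠ k ∧ d = circDist n j k}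

namespace LargeSieve

open Finset

theorem one_add_two_cos_mul_sq_le (θ : ℝ) (h0 : 0 ≤ θ) (h1 : θ ≤ Real.pi / 2) :
    (1 + 2 * Real.cos θ) * θ ^ 2 ≤ 3 * Real.sin θ ^ 2 := by
  have hθ2 : θ ≤ 2 := by linarith [Real.pi_le_four]
  have hs := Real.sin_ge_sub_cube h0
  have hs' := Real.sin_ge_sub_cube (x := θ / 2) (by linarith)
  have hc : Real.cos θ = 1 - 2 * Real.sin (θ / 2) ^ 2 := by
    have := Real.cos_sq' (θ / 2)
    have h2 := Real.cos_two_mul (θ / 2)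
    rw [mul_div_cancel₀ _ two_ne_zero] at h2
    linarith
  have hpos : 0 ≤ θ - θ ^ 3 / 6 := by nlinarith [mul_nonneg h0 h0]
  have hpos' : 0 ≤ θ / 2 - (θ / 2) ^ 3 / 6 := by nlinarith [mul_nonneg h0 h0]
  have e1 := pow_le_pow_left₀ hpos hs 2
  have e2 := pow_le_pow_left₀ hpos' hs' 2
  have hc' : Real.cos θ ≤ 1 - θ ^ 2 / 2 + θ ^ 4 / 24 := by
    rw [hc]
    nlinarith [pow_nonneg h0 6]
  nlinarith [mul_le_mul_of_nonneg_right hc' (sq_nonneg θ)]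

/-- The sum of the squares of the inverses of a `δ`-separated family of reals in `[δ, ∞)`. -/
theorem sum_inv_sq_le_of_separated {ι : Type*} (S : Finset ι) (f : ι → ℝ) (δ : ℝ) (hδ : 0 < δ)
    (hf : ∀ r ∈ S, δ ≤ f r) (hsep : ∀ r ∈ S, ∀ s ∈ S, r ≠ s → δ ≤ |f r - f s|) :
    ∑ r ∈ S, (f r ^ 2)⁻¹ ≤ Real.pi ^ 2 / 6 * (δ ^ 2)⁻¹ := by
  have hinj : Set.InjOn (fun r => ⌊f r / δ⌋₊) S := by
    intro r hr s hs hrs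
    by_contra hne
    have h1 := hsep r hr s hs hne
    have hr0 : 0 ≤ f r / δ := div_nonneg (hδ.le.trans (hf r hr)) hδ.le
    have hs0 : 0 ≤ f s / δ := div_nonneg (hδ.le.trans (hf s hs)) hδ.le
    have a1 := Nat.floor_le hr0
    have a2 := Nat.lt_floor_add_one (f r / δ)
    have a3 := Nat.floor_le hs0
    have a4 := Nat.lt_floor_add_one (f s / δ)
    simp only at hrs
    rw [hrs] at a1 a2
    have h2 : |f r / δ - f s / δ| < 1 := by rw [abs_lt]; constructor <;> linarith
    rw [← sub_div, abs_div, abs_of_pos hδ, div_lt_one hδ] at h2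
    linarith
  calc ∑ r ∈ S, (f r ^ 2)⁻¹
      ≤ ∑ r ∈ S, (1 / ((⌊f r / δ⌋₊ : ℕ) : ℝ) ^ 2) * (δ ^ 2)⁻¹ := by
        refine sum_le_sum fun r hr => ?_
        have hr0 : 0 ≤ f r / δ := div_nonneg (hδ.le.trans (hf r hr)) hδ.le
        have hk : 1 ≤ ⌊f r / δ⌋₊ := by
          rw [Nat.le_floor_iff hr0, Nat.cast_one, one_le_div hδ]
          exact hf r hr
        have hk' : (0 : ℝ) < (⌊f r / δ⌋₊ : ℕ) := by exact_mod_cast hk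
        have hle : (⌊f r / δ⌋₊ : ℝ) * δ ≤ f r := by
          rw [← le_div_iff₀ hδ]; exact Nat.floor_le hr0
        rw [one_div, ← mul_inv, ← mul_pow]
        gcongr
    _ = (∑ k ∈ S.image (fun r => ⌊f r / δ⌋₊), 1 / (k : ℝ) ^ 2) * (δ ^ 2)⁻¹ := by
        rw [sum_image hinj, sum_mul]
    _ ≤ Real.pi ^ 2 / 6 * (δ ^ 2)⁻¹ := by
        gcongr
        exact sum_le_hasSum _ (fun _ _ => by positivity) hasSum_zeta_two

/-- A family of reals is `δ`-separated modulo one. -/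
def SeparatedModOne {ι : Type*} (x : ι → ℝ) (δ : ℝ) : Prop :=
  ∀ r s, r ≠ s → ∀ k : ℤ, δ ≤ |x r - x s - k|

/-- `csc (π (x r - x s))`, with value `0` on the diagonal. -/
noncomputable def cscDiff {ι : Type*} (x : ι → ℝ) (r s : ι) : ℝ :=
  (Real.sin (Real.pi * (x r - x s)))⁻¹

/-- `cot (π (x r - x s))`, with value `0` on the diagonal. -/
noncomputable def cotDiff {ι : Type*} (x : ι → ℝ) (r s : ι) : ℝ :=
  Real.cos (Real.pi * (x r - x s)) / Real.sin (Real.pi * (x r - x s))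

section
variable {ι : Type*} {x : ι → ℝ} {δ : ℝ}

theorem cscDiff_self (r : ι) : cscDiff x r r = 0 := by simp [cscDiff]

theorem cotDiff_self (r : ι) : cotDiff x r r = 0 := by simp [cotDiff]

theorem cscDiff_swap (r s : ι) : cscDiff x s r = -cscDiff x r s := by
  rw [cscDiff, cscDiff, ← neg_sub (x r), mul_neg, Real.sin_neg, inv_neg]

theorem cotDiff_swap (r s : ι) : cotDiff x s r = -cotDiff x r s := by
  rw [cotDiff, cotDiff, ← neg_sub (x r), mul_neg, Real.sin_neg, Real.cos_neg, div_neg]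

theorem SeparatedModOne.sin_ne_zero (h : SeparatedModOne x δ) (hδ : 0 < δ) {r s : ι}
    (hrs : r ≠ s) : Real.sin (Real.pi * (x r - x s)) ≠ 0 := by
  intro h0
  obtain ⟨k, hk⟩ := Real.sin_eq_zero_iff.1 h0
  rw [mul_comm, mul_right_inj' Real.pi_ne_zero] at hk
  have := h r s hrs k
  rw [← hk, sub_self, abs_zero] at this
  linarith

theorem csc_sq_add_le (y : ℝ) (hy : Real.sin (Real.pi * y) ≠ 0) :
    ((Real.sin (Real.pi * y))⁻¹) ^ 2 +
      2 * |(Real.sin (Real.pi * y))⁻¹ * (Real.cos (Real.pi * y) / Real.sin (Real.pi * y))| ≤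
      3 / Real.pi ^ 2 * ((y - round y) ^ 2)⁻¹ := by
  set z := y - round y with hz
  have hyz : Real.pi * y = Real.pi * z + round y * Real.pi := by rw [hz]; ring
  have hza : |z| ≤ 1 / 2 := abs_sub_round y
  have hsin : |Real.sin (Real.pi * y)| = Real.sin (Real.pi * |z|) := by
    rw [hyz, Real.sin_add_int_mul_pi, abs_mul, abs_zpow, abs_neg, abs_one, one_zpow, one_mul]
    rcases abs_cases z with ⟨h, h'⟩ | ⟨h, h'⟩ <;> rw [h] at hza ⊢
    · exact abs_of_nonneg (Real.sin_nonneg_of_nonneg_of_le_pi (by positivity)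
        (by nlinarith [Real.pi_pos]))
    · rw [mul_neg, Real.sin_neg]
      exact abs_of_nonpos (Real.sin_nonpos_of_nonpos_of_neg_pi_le
        (by nlinarith [Real.pi_pos]) (by nlinarith [Real.pi_pos]))
  have hcos : |Real.cos (Real.pi * y)| = Real.cos (Real.pi * |z|) := by
    rw [hyz, Real.cos_add_int_mul_pi, abs_mul, abs_zpow, abs_neg, abs_one, one_zpow, one_mul,
      ← Real.cos_abs (Real.pi * z), abs_mul, abs_of_pos Real.pi_pos]
    exact abs_of_nonneg (Real.cos_nonneg_of_neg_pi_div_two_le_of_le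
      (by nlinarith [Real.pi_pos, abs_nonneg z]) (by nlinarith [Real.pi_pos]))
  have hs0 : 0 < Real.sin (Real.pi * |z|) := by rw [← hsin]; exact abs_pos.2 hy
  have hz0 : 0 < |z| := by
    rcases (abs_nonneg z).lt_or_eq with h | h
    · exact h
    · rw [← h] at hs0; simp at hs0
  have key := one_add_two_cos_mul_sq_le (Real.pi * |z|) (by positivity)
    (by nlinarith [Real.pi_pos])
  rw [abs_mul, abs_div, ← sq_abs (_⁻¹), abs_inv, hsin, hcos, ← sq_abs z]
  have : (Real.sin (Real.pi * |z|))⁻¹ ^ 2 + 2 * ((Real.sin (Real.pi * |z|))⁻¹ *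
      (Real.cos (Real.pi * |z|) / Real.sin (Real.pi * |z|))) =
      (1 + 2 * Real.cos (Real.pi * |z|)) / Real.sin (Real.pi * |z|) ^ 2 := by
    field_simp
  rw [this, div_le_iff₀ (by positivity)]
  have : 3 / Real.pi ^ 2 * (|z| ^ 2)⁻¹ * Real.sin (Real.pi * |z|) ^ 2 =
      3 * Real.sin (Real.pi * |z|) ^ 2 / (Real.pi * |z|) ^ 2 := by
    field_simp
  rw [this, le_div_iff₀ (by positivity)]
  exact key

theorem SeparatedModOne.sum_csc_le [Fintype ι] [DecidableEq ι] (h : SeparatedModOne x δ)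
    (hδ : 0 < δ) (s : ι) :
    ∑ r, (cscDiff x s r ^ 2 + 2 * |cscDiff x s r * cotDiff x s r|) ≤ (δ ^ 2)⁻¹ := by
  set y : ι → ℝ := fun r => (x s - x r) - round (x s - x r) with hy
  have hy0 : ∀ r, r ≠ s → δ ≤ |y r| := fun r hr => h s r hr.symm _
  have hsep : ∀ r t, r ≠ t → δ ≤ |y r - y t| := by
    intro r t hrt
    have := h r t hrt (round (x s - x t) - round (x s - x r))
    rw [← abs_neg] at this
    convert this using 2
    simp only [hy]; push_cast; ring
  have hP := sum_inv_sq_le_of_separated ((univ.erase s).filter fun r => 0 ≤ y r) y δ hδ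
    (fun r hr => by
      simp only [mem_filter, mem_erase] at hr
      have := hy0 r hr.1.1
      rwa [abs_of_nonneg hr.2] at this)
    (fun r _ t _ => hsep r t)
  have hN := sum_inv_sq_le_of_separated ((univ.erase s).filter fun r => ¬ 0 ≤ y r) (fun r => -y r)
    δ hδ
    (fun r hr => by
      simp only [mem_filter, mem_erase, not_le] at hr
      have := hy0 r hr.1.1
      rwa [abs_of_neg hr.2] at this)
    (fun r _ t _ hrt => by
      rw [← neg_sub', abs_neg]; exact hsep r t hrt)
  simp only [neg_sq] at hN
  have hsum := sum_filter_add_sum_filter_not (univ.erase s) (fun r => 0 ≤ y r)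
    (fun r => (y r ^ 2)⁻¹)
  rw [← add_sum_erase _ _ (mem_univ s), cscDiff_self, cotDiff_self]
  calc _ ≤ ∑ r ∈ univ.erase s, 3 / Real.pi ^ 2 * (y r ^ 2)⁻¹ := by
        simp only [mul_zero, abs_zero, ne_eq, OfNat.ofNat_ne_zero, not_false_eq_true, zero_pow,
          add_zero, zero_add]
        exact sum_le_sum fun r hr => csc_sq_add_le _ (h.sin_ne_zero hδ (ne_of_mem_erase hr).symm)
    _ ≤ 3 / Real.pi ^ 2 * (Real.pi ^ 2 / 6 * (δ ^ 2)⁻¹ + Real.pi ^ 2 / 6 * (δ ^ 2)⁻¹) := by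
        rw [← mul_sum, ← hsum]
        gcongr
    _ = (δ ^ 2)⁻¹ := by
        have := Real.pi_ne_zero
        field_simp
        norm_num

theorem SeparatedModOne.csc_mul_csc [DecidableEq ι] (h : SeparatedModOne x δ) (hδ : 0 < δ)
    (r s t : ι) :
    cscDiff x r s * cscDiff x r t = cscDiff x s t * (cotDiff x r s - cotDiff x r t) +
      (if s = t then cscDiff x r s ^ 2 else 0) +
      (if r = s then cscDiff x s t * cotDiff x s t else 0) +
      (if r = t then cscDiff x s t * cotDiff x s t else 0) := by
  by_cases hst : s = t
  · subst hst
    simp [cscDiff_self, sq]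
  by_cases hrs : r = s
  · subst hrs
    simp [cscDiff_self, cotDiff_self, hst]
  by_cases hrt : r = t
  · subst hrt
    simp [cscDiff_self, cotDiff_self, hst, hrs, cotDiff_swap s r]
  simp only [hst, hrs, hrt, if_false, add_zero]
  have h1 := h.sin_ne_zero hδ hst
  have h2 := h.sin_ne_zero hδ hrs
  have h3 := h.sin_ne_zero hδ hrt
  have key : Real.sin (Real.pi * (x s - x t)) =
      Real.sin (Real.pi * (x r - x t)) * Real.cos (Real.pi * (x r - x s)) -
      Real.cos (Real.pi * (x r - x t)) * Real.sin (Real.pi * (x r - x s)) := by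
    rw [← Real.sin_sub]; congr 1; ring
  have key' : Real.cos (Real.pi * (x r - x s)) * Real.sin (Real.pi * (x r - x t)) -
      Real.sin (Real.pi * (x r - x s)) * Real.cos (Real.pi * (x r - x t)) =
      Real.sin (Real.pi * (x s - x t)) := by rw [key]; ring
  simp only [cscDiff, cotDiff]
  rw [div_sub_div _ _ h2 h3, key']
  field_simp

open scoped ComplexOrder in
/-- The quadratic form of a Hermitian matrix is bounded by any bound for its eigenvalues. -/
theorem re_dotProduct_mulVec_le [Fintype ι] [DecidableEq ι]
    {A : Matrix ι ι ℂ} (hA : A.IsHermitian) {C : ℝ} (hC : 0 ≤ C)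
    (h : ∀ (μ : ℝ) (v : ι → ℂ), A.mulVec v = (μ : ℂ) • v →
      μ ^ 2 * ∑ i, ‖v i‖ ^ 2 ≤ C ^ 2 * ∑ i, ‖v i‖ ^ 2) (v : ι → ℂ) :
    (star v ⬝ᵥ A.mulVec v).re ≤ C * ∑ i, ‖v i‖ ^ 2 := by
  have hB : ((C : ℂ) • (1 : Matrix ι ι ℂ) - A).IsHermitian := by
    refine Matrix.IsHermitian.sub ?_ hA
    rw [Matrix.IsHermitian, Matrix.conjTranspose_smul, Matrix.conjTranspose_one]
    simp
  have hpsd : ((C : ℂ) • (1 : Matrix ι ι ℂ) - A).PosSemidef := by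
    rw [hB.posSemidef_iff_eigenvalues_nonneg]
    intro j
    have h1 := hB.mulVec_eigenvectorBasis j
    set w : ι → ℂ := (hB.eigenvectorBasis j).ofLp with hw
    have hnorm : ∑ i, ‖w i‖ ^ 2 = 1 := by
      have := hB.eigenvectorBasis.orthonormal.1 j
      rw [← EuclideanSpace.norm_sq_eq, this, one_pow]
    have h2 : A.mulVec w = ((C - hB.eigenvalues j : ℝ) : ℂ) • w := by
      rw [Matrix.sub_mulVec, Matrix.smul_mulVec, Matrix.one_mulVec] at h1
      push_cast
      rw [sub_smul, ← Complex.coe_smul, ← h1] at *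
      abel
    have h3 := h _ _ h2
    rw [hnorm, mul_one, mul_one] at h3
    have := abs_le_of_sq_le_sq h3 hC
    simp only [Pi.zero_apply]
    linarith [(abs_le.1 this).2]
  have := hpsd.re_dotProduct_nonneg v
  rw [Matrix.sub_mulVec, Matrix.smul_mulVec, Matrix.one_mulVec, dotProduct_sub,
    dotProduct_smul] at this
  have hvv : star v ⬝ᵥ v = ((∑ i, ‖v i‖ ^ 2 : ℝ) : ℂ) := by
    simp [dotProduct, Complex.conj_mul']
  rw [hvv, smul_eq_mul, ← Complex.ofReal_mul, map_sub, RCLike.re_eq_complex_re,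
    Complex.ofReal_re] at this
  linarith

open ComplexConjugate in
theorem SeparatedModOne.sq_eigenvalue_le [Fintype ι] [DecidableEq ι] (h : SeparatedModOne x δ)
    (hδ : 0 < δ) (μ : ℝ) (v : ι → ℂ)
    (hv : ∀ s, ∑ t, (cscDiff x s t : ℂ) * v t = Complex.I * μ * v s) :
    μ ^ 2 * ∑ i, ‖v i‖ ^ 2 ≤ δ⁻¹ ^ 2 * ∑ i, ‖v i‖ ^ 2 := by
  have hv' : ∀ t, ∑ s, (cscDiff x s t : ℂ) * v s = -(Complex.I * μ * v t) := by
    intro t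
    rw [← hv t, ← sum_neg_distrib]
    refine sum_congr rfl fun s _ => ?_
    rw [cscDiff_swap t s]; push_cast; ring
  have hvc : ∀ s, ∑ t, (cscDiff x s t : ℂ) * conj (v t) = -(Complex.I * μ * conj (v s)) := by
    intro s
    have := congrArg conj (hv s)
    simpa using this
  set C : ι → ℂ := fun s => ∑ r, (cotDiff x r s : ℂ) with hC
  have hG : ∀ s t, ∑ r, (cscDiff x r s : ℂ) * cscDiff x r t =
      cscDiff x s t * (C s - C t) + (if s = t then ∑ r, (cscDiff x r s : ℂ) ^ 2 else 0) +
      2 * (cscDiff x s t * cotDiff x s t) := by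
    intro s t
    have : ∀ r, (cscDiff x r s : ℂ) * cscDiff x r t =
      cscDiff x s t * (cotDiff x r s - cotDiff x r t) +
      (if s = t then (cscDiff x r s : ℂ) ^ 2 else 0) +
      (if r = s then (cscDiff x s t * cotDiff x s t : ℂ) else 0) +
      (if r = t then (cscDiff x s t * cotDiff x s t : ℂ) else 0) := by
      intro r
      have := congrArg (fun z : ℝ => (z : ℂ)) (h.csc_mul_csc hδ r s t)
      push_cast [apply_ite (fun z : ℝ => (z : ℂ))] at this
      exact this
    rw [sum_congr rfl fun r _ => this r]
    simp only [sum_add_distrib, ← mul_sum, sum_sub_distrib, sum_ite_eq', mem_univ, if_true, hC]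
    split_ifs
    · ring
    · simp; ring
  have hfull : ((μ ^ 2 * ∑ i, ‖v i‖ ^ 2 : ℝ) : ℂ) =
      ∑ s, ∑ t, (∑ r, (cscDiff x r s : ℂ) * cscDiff x r t) * (v s * conj (v t)) := by
    have : ∀ r, ((μ ^ 2 * ‖v r‖ ^ 2 : ℝ) : ℂ) =
        ∑ s, ∑ t, (cscDiff x r s : ℂ) * cscDiff x r t * (v s * conj (v t)) := by
      intro r
      have e : ((μ ^ 2 * ‖v r‖ ^ 2 : ℝ) : ℂ) =
          (∑ s, (cscDiff x r s : ℂ) * v s) * (∑ t, (cscDiff x r t : ℂ) * conj (v t)) := by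
        rw [hv, hvc]
        push_cast
        rw [← Complex.mul_conj']
        linear_combination ((μ : ℂ) ^ 2 * (v r * conj (v r))) * Complex.I_sq
      rw [e, sum_mul_sum]
      exact sum_congr rfl fun s _ => sum_congr rfl fun t _ => by ring
    rw [mul_sum, Complex.ofReal_sum, sum_congr rfl fun r _ => this r, sum_comm]
    refine sum_congr rfl fun s _ => ?_
    rw [sum_comm]
    exact sum_congr rfl fun t _ => by rw [sum_mul]
  have hcancel : ∑ s, ∑ t, (cscDiff x s t * (C s - C t) : ℂ) * (v s * conj (v t)) = 0 := by
    have e1 : ∑ s, ∑ t, (cscDiff x s t * C s : ℂ) * (v s * conj (v t)) =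
        ∑ s, C s * v s * -(Complex.I * μ * conj (v s)) := by
      refine sum_congr rfl fun s _ => ?_
      rw [← hvc, mul_sum]
      exact sum_congr rfl fun t _ => by ring
    have e2 : ∑ s, ∑ t, (cscDiff x s t * C t : ℂ) * (v s * conj (v t)) =
        ∑ t, C t * conj (v t) * -(Complex.I * μ * v t) := by
      rw [sum_comm]
      refine sum_congr rfl fun s _ => ?_
      rw [← hv', mul_sum]
      exact sum_congr rfl fun t _ => by ring
    simp only [mul_sub, sub_mul, sum_sub_distrib]
    rw [e1, e2, ← sum_sub_distrib]
    exact sum_eq_zero fun s _ => by ring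
  have hmain : ((μ ^ 2 * ∑ i, ‖v i‖ ^ 2 : ℝ) : ℂ) =
      ((∑ s, (∑ r, cscDiff x s r ^ 2) * ‖v s‖ ^ 2 : ℝ) : ℂ) +
        ∑ s, ∑ t, (2 * (cscDiff x s t * cotDiff x s t) : ℂ) * (v s * conj (v t)) := by
    rw [hfull]
    simp only [hG, add_mul, sum_add_distrib]
    rw [hcancel, zero_add]
    congr 1
    simp only [ite_mul, zero_mul, sum_ite_eq, mem_univ, if_true]
    push_cast
    refine sum_congr rfl fun s _ => ?_
    rw [Complex.mul_conj']
    congr 1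
    exact sum_congr rfl fun r _ => by rw [cscDiff_swap s r]; push_cast; ring
  have hre := congrArg Complex.re hmain
  rw [Complex.ofReal_re, Complex.add_re, Complex.ofReal_re] at hre
  have hsym : ∑ s, ∑ t, |cscDiff x s t * cotDiff x s t| * ‖v t‖ ^ 2 =
      ∑ s, ∑ t, |cscDiff x s t * cotDiff x s t| * ‖v s‖ ^ 2 := by
    rw [sum_comm]
    refine sum_congr rfl fun s _ => sum_congr rfl fun t _ => ?_
    rw [cscDiff_swap s t, cotDiff_swap s t, neg_mul_neg]
  have hcross : (∑ s, ∑ t, (2 * (cscDiff x s t * cotDiff x s t) : ℂ) * (v s * conj (v t))).re ≤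
      ∑ s, ∑ t, 2 * |cscDiff x s t * cotDiff x s t| * ‖v s‖ ^ 2 := by
    calc _ ≤ ∑ s, ∑ t, (|cscDiff x s t * cotDiff x s t| * ‖v s‖ ^ 2 +
          |cscDiff x s t * cotDiff x s t| * ‖v t‖ ^ 2) := by
          simp only [Complex.re_sum]
          refine sum_le_sum fun s _ => sum_le_sum fun t _ => ?_
          refine (Complex.re_le_norm _).trans ?_
          rw [← Complex.ofReal_mul, norm_mul, norm_mul, norm_mul, Complex.norm_real,
            Complex.norm_conj, Real.norm_eq_abs, Complex.norm_ofNat]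
          nlinarith [mul_nonneg (abs_nonneg (cscDiff x s t * cotDiff x s t))
            (sq_nonneg (‖v s‖ - ‖v t‖))]
      _ = _ := by
          simp only [sum_add_distrib]
          rw [hsym]
          simp only [← sum_add_distrib]
          exact sum_congr rfl fun s _ => sum_congr rfl fun t _ => by ring
  calc μ ^ 2 * ∑ i, ‖v i‖ ^ 2
      ≤ ∑ s, (∑ r, cscDiff x s r ^ 2) * ‖v s‖ ^ 2 +
        ∑ s, ∑ t, 2 * |cscDiff x s t * cotDiff x s t| * ‖v s‖ ^ 2 := by
        rw [hre]; gcongr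
    _ = ∑ s, (∑ r, (cscDiff x s r ^ 2 + 2 * |cscDiff x s r * cotDiff x s r|)) * ‖v s‖ ^ 2 := by
        rw [← sum_add_distrib]
        refine sum_congr rfl fun s _ => ?_
        rw [sum_add_distrib, add_mul]
        congr 1
        rw [sum_mul]
    _ ≤ ∑ s, (δ ^ 2)⁻¹ * ‖v s‖ ^ 2 := by
        gcongr with s _
        exact h.sum_csc_le hδ s
    _ = δ⁻¹ ^ 2 * ∑ i, ‖v i‖ ^ 2 := by rw [mul_sum, inv_pow]

open ComplexConjugate in
/-- The Hilbert inequality of Montgomery and Vaughan, in its cosecant form. -/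
theorem SeparatedModOne.norm_sum_csc_le [Fintype ι] [DecidableEq ι] (h : SeparatedModOne x δ)
    (hδ : 0 < δ) (v : ι → ℂ) :
    |(∑ s, ∑ t, Complex.I * cscDiff x s t * (conj (v s) * v t)).re| ≤ δ⁻¹ * ∑ i, ‖v i‖ ^ 2 := by
  set A : Matrix ι ι ℂ := fun s t => Complex.I * cscDiff x s t with hA
  have hherm : A.IsHermitian := by
    ext s t
    rw [Matrix.conjTranspose_apply]
    simp [hA, cscDiff_swap s t]
  have heig : ∀ (μ : ℝ) (w : ι → ℂ), A.mulVec w = (μ : ℂ) • w →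
      μ ^ 2 * ∑ i, ‖w i‖ ^ 2 ≤ δ⁻¹ ^ 2 * ∑ i, ‖w i‖ ^ 2 := by
    intro μ w hw
    rw [← neg_sq]
    refine h.sq_eigenvalue_le hδ (-μ) w fun s => ?_
    have := congrFun hw s
    simp only [hA, Matrix.mulVec, dotProduct, mul_assoc, ← mul_sum, Pi.smul_apply,
      smul_eq_mul] at this
    push_cast
    linear_combination (-Complex.I) * this + (∑ t, (cscDiff x s t : ℂ) * w t) * Complex.I_sq
  have hQ : ∑ s, ∑ t, Complex.I * cscDiff x s t * (conj (v s) * v t) =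
      star v ⬝ᵥ A.mulVec v := by
    simp only [dotProduct, Matrix.mulVec, mul_sum, hA]
    exact sum_congr rfl fun s _ => sum_congr rfl fun t _ => by
      simp only [Pi.star_apply, RCLike.star_def]; ring
  rw [hQ, abs_le]
  have h1 := re_dotProduct_mulVec_le hherm (inv_nonneg.2 hδ.le) heig v
  have h2 := re_dotProduct_mulVec_le hherm.neg (inv_nonneg.2 hδ.le) (fun μ w hw => by
    rw [← neg_sq]
    refine heig (-μ) w ?_
    rw [Matrix.neg_mulVec] at hw
    rw [← neg_neg (A.mulVec w), hw]
    simp) v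
  rw [Matrix.neg_mulVec, dotProduct_neg, Complex.neg_re] at h2
  exact ⟨by linarith, h1⟩

theorem sum_range_exp_eq (N : ℕ) (θ : ℝ) (h : Real.sin (Real.pi * θ) ≠ 0) :
    ∑ t ∈ range N, Complex.exp (2 * Real.pi * Complex.I * (t * θ)) =
      (Complex.exp (2 * Real.pi * Complex.I * ((N - 1 / 2) * θ)) -
        Complex.exp (2 * Real.pi * Complex.I * (-(1 / 2) * θ))) *
        (-(Complex.I / 2) * ((Real.sin (Real.pi * θ))⁻¹ : ℝ)) := by
  have hs : ((Real.sin (Real.pi * θ) : ℝ) : ℂ) =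
      (Complex.exp (2 * Real.pi * Complex.I * (-(1 / 2) * θ)) -
        Complex.exp (2 * Real.pi * Complex.I * (1 / 2 * θ))) * Complex.I / 2 := by
    rw [Complex.ofReal_sin, Complex.sin]
    push_cast
    congr 3 <;> (congr 1; ring)
  have hs0 : ((Real.sin (Real.pi * θ) : ℝ) : ℂ) ≠ 0 := by exact_mod_cast h
  induction N with
  | zero => simp
  | succ N ih =>
    rw [sum_range_succ, ih, Complex.ofReal_inv]
    have e1 : Complex.exp (2 * Real.pi * Complex.I * ((N - 1 / 2) * θ)) =
        Complex.exp (2 * Real.pi * Complex.I * (N * θ)) *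
          Complex.exp (2 * Real.pi * Complex.I * (-(1 / 2) * θ)) := by
      rw [← Complex.exp_add]; congr 1; ring
    have e2 : Complex.exp (2 * Real.pi * Complex.I * (((N + 1 : ℕ) - 1 / 2) * θ)) =
        Complex.exp (2 * Real.pi * Complex.I * (N * θ)) *
          Complex.exp (2 * Real.pi * Complex.I * (1 / 2 * θ)) := by
      rw [← Complex.exp_add]; congr 1; push_cast; ring
    rw [e1, e2]
    generalize Complex.exp (2 * Real.pi * Complex.I * (N * θ)) = a
    linear_combination (-a) * mul_inv_cancel₀ hs0 + a * ((Real.sin (Real.pi * θ) : ℝ) : ℂ)⁻¹ * hs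

open ComplexConjugate in
theorem conj_exp_two_pi_I_mul (a : ℝ) : conj (Complex.exp (2 * Real.pi * Complex.I * a)) =
    Complex.exp (2 * Real.pi * Complex.I * -a) := by
  rw [← Complex.exp_conj]
  simp [Complex.conj_ofNat]

theorem norm_exp_two_pi_I_mul (a : ℝ) : ‖Complex.exp (2 * Real.pi * Complex.I * a)‖ = 1 := by
  rw [show (2 * Real.pi * Complex.I * a : ℂ) = ((2 * Real.pi * a : ℝ) : ℂ) * Complex.I by
    push_cast; ring]
  exact Complex.norm_exp_ofReal_mul_I _

open ComplexConjugate in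
/-- The dual large sieve inequality with the constant `N + δ⁻¹`. -/
theorem SeparatedModOne.sum_norm_sq_le_add [Fintype ι] [DecidableEq ι]
    (h : SeparatedModOne x δ) (hδ : 0 < δ) (N : ℕ) (u : ι → ℂ) :
    ∑ t ∈ range N, ‖∑ r, u r * Complex.exp (2 * Real.pi * Complex.I * (t * x r))‖ ^ 2 ≤
      (N + δ⁻¹) * ∑ r, ‖u r‖ ^ 2 := by
  set v : ι → ℂ := fun r =>
    u r * Complex.exp (2 * Real.pi * Complex.I * ((N - 1 / 2 : ℝ) * x r : ℝ)) with hv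
  set w : ι → ℂ := fun r =>
    u r * Complex.exp (2 * Real.pi * Complex.I * (-(1 / 2 : ℝ) * x r : ℝ)) with hw
  have hvn : ∀ r, ‖v r‖ = ‖u r‖ := fun r => by
    rw [hv, norm_mul, norm_exp_two_pi_I_mul, mul_one]
  have hwn : ∀ r, ‖w r‖ = ‖u r‖ := fun r => by
    rw [hw, norm_mul, norm_exp_two_pi_I_mul, mul_one]
  have hterm : ∀ s r, conj (u s) * u r *
      ∑ t ∈ range N, Complex.exp (2 * Real.pi * Complex.I * (t * (x r - x s : ℝ))) =
      (if s = r then (N : ℂ) * ((‖u s‖ ^ 2 : ℝ) : ℂ) else 0) +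
        (1 / 2) * (Complex.I * cscDiff x s r * (conj (v s) * v r)) -
        (1 / 2) * (Complex.I * cscDiff x s r * (conj (w s) * w r)) := by
    intro s r
    by_cases hsr : s = r
    · subst hsr
      simp [cscDiff_self, Complex.conj_mul', mul_comm (N : ℂ)]
    · rw [if_neg hsr, sum_range_exp_eq _ _ (h.sin_ne_zero hδ (Ne.symm hsr))]
      have hb : (Real.sin (Real.pi * (x r - x s)))⁻¹ = -cscDiff x s r := cscDiff_swap s r
      have e : ∀ c : ℝ, Complex.exp (2 * Real.pi * Complex.I * (c * (x r - x s : ℝ))) =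
          Complex.exp (2 * Real.pi * Complex.I * -(c * x s : ℝ)) *
            Complex.exp (2 * Real.pi * Complex.I * (c * x r : ℝ)) := by
        intro c
        rw [← Complex.exp_add]; congr 1; push_cast; ring
      have e1 := e (N - 1 / 2)
      have e2 := e (-(1 / 2))
      rw [hb, hv, hw]
      simp only [map_mul, conj_exp_two_pi_I_mul]
      push_cast at e1 e2 ⊢
      rw [e1, e2]
      ring
  have hexp : ((∑ t ∈ range N,
      ‖∑ r, u r * Complex.exp (2 * Real.pi * Complex.I * (t * x r))‖ ^ 2 : ℝ) : ℂ) =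
      ∑ s, ∑ r, conj (u s) * u r *
        ∑ t ∈ range N, Complex.exp (2 * Real.pi * Complex.I * (t * (x r - x s : ℝ))) := by
    push_cast
    simp only [← Complex.conj_mul', map_sum, mul_sum]
    simp only [sum_mul]
    rw [sum_comm]
    refine (sum_congr rfl fun r _ => sum_comm).trans ?_
    rw [sum_comm]
    refine sum_congr rfl fun s _ => sum_congr rfl fun r _ => sum_congr rfl fun t _ => ?_
    have := conj_exp_two_pi_I_mul (t * x s)
    push_cast at this
    rw [map_mul, this, mul_mul_mul_comm, ← Complex.exp_add]
    congr 2; ring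
  have hre := congrArg Complex.re hexp
  rw [Complex.ofReal_re] at hre
  simp only [hterm, sum_sub_distrib, sum_add_distrib, sum_ite_eq, mem_univ, if_true,
    ← mul_sum] at hre
  have h2 : ∀ z : ℂ, ((1 / 2 : ℂ) * z).re = 1 / 2 * z.re := fun z => by
    rw [show (1 / 2 : ℂ) = ((1 / 2 : ℝ) : ℂ) by push_cast; rfl, Complex.re_ofReal_mul]
  rw [Complex.sub_re, Complex.add_re, h2, h2, ← Complex.ofReal_sum, ← Complex.ofReal_natCast,
    ← Complex.ofReal_mul, Complex.ofReal_re] at hre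
  have b1 := (abs_le.1 (h.norm_sum_csc_le hδ v)).2
  have b2 := (abs_le.1 (h.norm_sum_csc_le hδ w)).1
  simp only [hvn] at b1
  simp only [hwn] at b2
  rw [hre]
  linarith

/-- The dual large sieve inequality with the optimal constant `N - 1 + δ⁻¹`. -/
theorem SeparatedModOne.sum_norm_sq_le [Fintype ι] [DecidableEq ι]
    (h : SeparatedModOne x δ) (hδ : 0 < δ) (hδ1 : δ ≤ 1) (N : ℕ) (u : ι → ℂ) :
    ∑ t ∈ range N, ‖∑ r, u r * Complex.exp (2 * Real.pi * Complex.I * (t * x r))‖ ^ 2 ≤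
      (N - 1 + δ⁻¹) * ∑ r, ‖u r‖ ^ 2 := by
  have hU : 0 ≤ ∑ r, ‖u r‖ ^ 2 := sum_nonneg fun _ _ => by positivity
  rcases N with _ | N
  · have : 1 ≤ δ⁻¹ := (one_le_inv₀ hδ).2 hδ1
    rw [range_zero, sum_empty]
    exact mul_nonneg (by push_cast; linarith) hU
  set S := ∑ t ∈ range (N + 1),
    ‖∑ r, u r * Complex.exp (2 * Real.pi * Complex.I * (t * x r))‖ ^ 2 with hS
  have key : ∀ L : ℕ, S ≤ (N + δ⁻¹) * (∑ r, ‖u r‖ ^ 2) +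
      (∑ r, ‖u r‖ ^ 2) * (1 / ((L : ℝ) + 1)) := by
    intro L
    have hL : (0 : ℝ) < L + 1 := by positivity
    have hL' : ((L : ℂ) + 1) ≠ 0 := by exact_mod_cast hL.ne'
    set y : ι × Fin (L + 1) → ℝ := fun p => (x p.1 + (p.2 : ℕ)) / (L + 1) with hy
    have hsep : SeparatedModOne y (δ / (L + 1)) := by
      rintro ⟨r, i⟩ ⟨s, j⟩ hne k
      have e : y (r, i) - y (s, j) - k =
          (x r - x s - ((k * (L + 1) + (j : ℕ) - (i : ℕ) : ℤ) : ℝ)) / (L + 1) := by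
        simp only [hy]; push_cast; field_simp; ring
      rw [e, abs_div, abs_of_pos hL]
      gcongr
      by_cases hrs : r = s
      · subst hrs
        rw [sub_self, zero_sub, abs_neg, ← Int.cast_abs]
        refine hδ1.trans ?_
        have hij : (i : ℕ) ≠ j := fun hc => hne (by rw [Fin.ext hc])
        have : (k * (L + 1) + (j : ℕ) - (i : ℕ) : ℤ) ≠ 0 := by
          intro h0
          have hi := i.2
          have hj := j.2
          rcases lt_trichotomy k 0 with hk | hk | hk
          · nlinarith
          · subst hk; omega
          · nlinarith
        exact_mod_cast Int.one_le_abs this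
      · exact h r s hrs _
    have hbig := hsep.sum_norm_sq_le_add (div_pos hδ hL) ((L + 1) * N + 1) (fun p => u p.1)
    have hcol : ∀ t : ℕ, ∑ p : ι × Fin (L + 1), u p.1 *
        Complex.exp (2 * Real.pi * Complex.I * (((L + 1) * t : ℕ) * y p)) =
        (L + 1) * ∑ r, u r * Complex.exp (2 * Real.pi * Complex.I * (t * x r)) := by
      intro t
      rw [Fintype.sum_prod_type, mul_sum]
      refine sum_congr rfl fun r _ => ?_
      have : ∀ j : Fin (L + 1),
          Complex.exp (2 * Real.pi * Complex.I * (((L + 1) * t : ℕ) * y (r, j))) =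
          Complex.exp (2 * Real.pi * Complex.I * (t * x r)) := by
        intro j
        rw [Complex.exp_eq_exp_iff_exists_int]
        refine ⟨t * (j : ℕ), ?_⟩
        simp only [hy]; push_cast
        field_simp
      simp only [this, sum_const, card_univ, Fintype.card_fin, nsmul_eq_mul]
      push_cast; rfl
    have hlow : (L + 1 : ℝ) ^ 2 * S ≤ ∑ m ∈ range ((L + 1) * N + 1), ‖∑ p : ι × Fin (L + 1),
        u p.1 * Complex.exp (2 * Real.pi * Complex.I * (m * y p))‖ ^ 2 := by
      have hinj : Set.InjOn (fun t : ℕ => (L + 1) * t) (range (N + 1)) :=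
        fun a _ b _ hab => Nat.eq_of_mul_eq_mul_left L.succ_pos hab
      calc _ = ∑ m ∈ (range (N + 1)).image (fun t => (L + 1) * t), ‖∑ p : ι × Fin (L + 1),
            u p.1 * Complex.exp (2 * Real.pi * Complex.I * (m * y p))‖ ^ 2 := by
            rw [sum_image hinj, hS, mul_sum]
            refine sum_congr rfl fun t _ => ?_
            have hn : ‖(L + 1 : ℂ)‖ = L + 1 := by exact_mod_cast Complex.norm_natCast (L + 1)
            rw [hcol, norm_mul, mul_pow, hn]
        _ ≤ _ := by
            refine sum_le_sum_of_subset_of_nonneg ?_ fun _ _ _ => by positivity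
            intro m hm
            obtain ⟨t, ht, rfl⟩ := mem_image.1 hm
            rw [mem_range] at ht ⊢
            exact Nat.lt_succ_of_le (Nat.mul_le_mul_left _ (Nat.le_of_lt_succ ht))
    have hr : ∑ p : ι × Fin (L + 1), ‖u p.1‖ ^ 2 = (L + 1) * ∑ r, ‖u r‖ ^ 2 := by
      rw [Fintype.sum_prod_type, mul_sum]
      simp
    rw [hr] at hbig
    have hfin := hlow.trans hbig
    rw [← le_div_iff₀' (by positivity)] at hfin
    refine hfin.trans (le_of_eq ?_)
    push_cast
    field_simp
    ring
  have hlim : Filter.Tendsto (fun L : ℕ => (N + δ⁻¹) * (∑ r, ‖u r‖ ^ 2) +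
      (∑ r, ‖u r‖ ^ 2) * (1 / ((L : ℝ) + 1))) Filter.atTop
      (nhds ((N + δ⁻¹) * (∑ r, ‖u r‖ ^ 2) + (∑ r, ‖u r‖ ^ 2) * 0)) :=
    (tendsto_one_div_add_atTop_nhds_zero_nat.const_mul _).const_add _
  have := ge_of_tendsto' hlim key
  rw [mul_zero, add_zero] at this
  push_cast
  rwa [add_sub_cancel_right]
end

/-- A dual bound for a matrix bounds its spectral norm. -/
theorem specNorm_sq_le_of_dual {α β : Type*} [Fintype α] [Fintype β] [DecidableEq β]
    (A : Matrix α β ℂ) {C : ℝ} (hC : 0 ≤ C)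
    (h : ∀ u : α → ℂ, ∑ t, ‖∑ r, u r * A r t‖ ^ 2 ≤ C * ∑ r, ‖u r‖ ^ 2) :
    specNorm A ^ 2 ≤ C := by
  suffices h' : specNorm A ≤ Real.sqrt C by
    calc specNorm A ^ 2 ≤ Real.sqrt C ^ 2 := pow_le_pow_left₀ (norm_nonneg _) h' 2
      _ = C := Real.sq_sqrt hC
  refine ContinuousLinearMap.opNorm_le_bound _ (Real.sqrt_nonneg _) fun a => ?_
  rw [LinearMap.coe_toContinuousLinearMap']
  set y := Matrix.toEuclideanLin A a with hy
  have hyr : ∀ r, y r = ∑ t, A r t * a t := fun r => rfl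
  set b : EuclideanSpace ℂ β := WithLp.toLp 2 fun t => ∑ r, star (y r) * A r t with hb
  have hb2 : ‖b‖ ^ 2 ≤ C * ‖y‖ ^ 2 := by
    rw [EuclideanSpace.norm_sq_eq, EuclideanSpace.norm_sq_eq]
    simpa [hb] using h fun r => star (y r)
  have hyy : ((‖y‖ ^ 2 : ℝ) : ℂ) = ∑ t, b t * a t := by
    rw [EuclideanSpace.norm_sq_eq]
    push_cast
    simp only [hb, sum_mul]
    rw [sum_comm]
    refine sum_congr rfl fun r _ => ?_
    rw [← Complex.conj_mul']
    nth_rewrite 2 [hyr]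
    rw [mul_sum]
    exact sum_congr rfl fun t _ => by rw [RCLike.star_def, mul_assoc]
  have hle : ‖y‖ ^ 2 ≤ ‖b‖ * ‖a‖ := by
    calc ‖y‖ ^ 2 = ‖((‖y‖ ^ 2 : ℝ) : ℂ)‖ := by
          rw [Complex.norm_real, Real.norm_of_nonneg (by positivity)]
      _ ≤ ∑ t, ‖b t‖ * ‖a t‖ := by
          rw [hyy]
          exact (norm_sum_le _ _).trans_eq (sum_congr rfl fun t _ => norm_mul _ _)
      _ ≤ ‖b‖ * ‖a‖ := by
          rw [EuclideanSpace.norm_eq b, EuclideanSpace.norm_eq a]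
          exact Real.sum_mul_le_sqrt_mul_sqrt _ _ _
  have hb1 : ‖b‖ ≤ Real.sqrt C * ‖y‖ := by
    rw [← Real.sqrt_sq (norm_nonneg y), ← Real.sqrt_mul hC]
    exact Real.le_sqrt_of_sq_le hb2
  rcases (norm_nonneg y).eq_or_lt with h0 | h0
  · rw [← h0]; positivity
  · refine le_of_mul_le_mul_left ?_ h0
    calc ‖y‖ * ‖y‖ = ‖y‖ ^ 2 := (sq _).symm
      _ ≤ ‖b‖ * ‖a‖ := hle
      _ ≤ Real.sqrt C * ‖y‖ * ‖a‖ := by gcongr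
      _ = ‖y‖ * (Real.sqrt C * ‖a‖) := by ring

theorem circDist_le_natAbs (n : ℕ) (j k : Fin n) (l : ℤ) :
    (circDist n j k : ℤ) ≤ |(j : ℤ) - (k : ℤ) - n * l| := by
  have hn : 0 < n := j.pos
  have aux : ∀ (a b : Fin n) (d : ℤ), (n : ℤ) ∣ (a : ℤ) - (b : ℤ) - d → 0 ≤ d →
      ((((a : ℕ) + n - (b : ℕ)) % n : ℕ) : ℤ) ≤ d := by
    intro a b d hd h0
    rw [Int.natCast_mod, Nat.cast_sub (by omega)]
    have : (((a : ℕ) + n : ℕ) - ((b : ℕ) : ℤ)) % n = d % n := by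
      refine Int.ModEq.symm ((Int.modEq_iff_dvd).2 ?_)
      push_cast
      have := dvd_add hd (dvd_refl (n : ℤ))
      rwa [show (a : ℤ) - b - d + n = (a : ℤ) + n - b - d by ring] at this
    rw [this]
    rw [Int.emod_def]
    have := mul_nonneg (Int.natCast_nonneg n) (Int.ediv_nonneg h0 (Int.natCast_nonneg n))
    linarith
  rw [circDist]
  rcases le_total 0 ((j : ℤ) - (k : ℤ) - n * l) with h | h
  · rw [abs_of_nonneg h]
    refine le_trans (by exact_mod_cast min_le_left _ _) (aux j k _ ⟨l, by ring⟩ h)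
  · rw [abs_of_nonpos h]
    refine le_trans (by exact_mod_cast min_le_right _ _) (aux k j _ ⟨-l, by ring⟩ (by linarith))

theorem circDist_pos {n : ℕ} {j k : Fin n} (h : j ≠ k) : 0 < circDist n j k := by
  have hne : (j : ℕ) ≠ k := fun hc => h (Fin.ext hc)
  have aux : ∀ a b : Fin n, (a : ℕ) ≠ b → 0 < ((a : ℕ) + n - (b : ℕ)) % n := by
    intro a b hab
    have ha := a.2
    have hb := b.2
    rcases lt_or_gt_of_ne hab with h | h
    · rw [Nat.mod_eq_of_lt (by omega)]; omega
    · rw [show (a : ℕ) + n - b = (a - b) + n by omega, Nat.add_mod_right,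
        Nat.mod_eq_of_lt (by omega)]
      omega
  exact lt_min (aux j k hne) (aux k j hne.symm)

theorem spread_le_circDist {n : ℕ} {Ω : Finset (Fin n)} {j k : Fin n} (hj : j ∈ Ω) (hk : k ∈ Ω)
    (h : j ≠ k) : spread n Ω ≤ circDist n j k :=
  Nat.sInf_le ⟨j, hj, k, hk, h, rfl⟩

theorem spread_pos {n : ℕ} {Ω : Finset (Fin n)} (hΩ : 2 ≤ Ω.card) : 0 < spread n Ω := by
  obtain ⟨j, hj, k, hk, hjk⟩ := one_lt_card.1 hΩ
  obtain ⟨a, -, b, -, hab, he⟩ := Nat.sInf_mem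
    (s := {d | ∃ j ∈ Ω, ∃ k ∈ Ω, j ≠ k ∧ d = circDist n j k}) ⟨_, j, hj, k, hk, hjk, rfl⟩
  rw [spread, he]
  exact circDist_pos hab

theorem spread_le {n : ℕ} {Ω : Finset (Fin n)} (hΩ : 2 ≤ Ω.card) : spread n Ω ≤ n := by
  obtain ⟨j, hj, k, hk, hjk⟩ := one_lt_card.1 hΩ
  exact (spread_le_circDist hj hk hjk).trans
    ((min_le_left _ _).trans (Nat.mod_lt _ j.pos).le)

theorem separatedModOne_of_spread {n : ℕ} (hn : 0 < n) (Ω : Finset (Fin n)) :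
    SeparatedModOne (fun ω : Ω => (((ω : Fin n) : ℕ) + 1 : ℝ) / n) ((spread n Ω : ℝ) / n) := by
  intro r s hrs l
  have hn' : (0 : ℝ) < n := by exact_mod_cast hn
  have h1 := spread_le_circDist r.2 s.2 (fun hc => hrs (Subtype.ext hc))
  have h2 := circDist_le_natAbs n r s l
  have h3 : (spread n Ω : ℤ) ≤ |((r : Fin n) : ℤ) - ((s : Fin n) : ℤ) - n * l| :=
    le_trans (by exact_mod_cast h1) h2
  have h4 : (spread n Ω : ℝ) ≤ |(((r : Fin n) : ℕ) : ℝ) - (((s : Fin n) : ℕ) : ℝ) - n * l| := by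
    exact_mod_cast h3
  have e : (((r : Fin n) : ℕ) + 1 : ℝ) / n - (((s : Fin n) : ℕ) + 1 : ℝ) / n - l =
      ((((r : Fin n) : ℕ) : ℝ) - (((s : Fin n) : ℕ) : ℝ) - n * l) / n := by
    field_simp; ring
  simp only
  rw [e, abs_div, abs_of_pos hn']
  gcongr

theorem specNorm_dftSub_sq_le (n : ℕ) (hn : 0 < n) (T Ω : Finset (Fin n)) (m : ℕ)
    (hT : ∀ t : Fin n, t ∈ T ↔ m ≤ (t : ℕ) ∧ (t : ℕ) < m + T.card) (hΩ : 2 ≤ Ω.card) :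
    specNorm (dftSub n Ω T) ^ 2 ≤ ((T.card : ℝ) + (n : ℝ) / (spread n Ω : ℝ) - 1) / n := by
  have hn' : (0 : ℝ) < n := by exact_mod_cast hn
  have hs : (0 : ℝ) < spread n Ω := by exact_mod_cast spread_pos hΩ
  have hsn : (spread n Ω : ℝ) ≤ n := by exact_mod_cast spread_le hΩ
  have h1 : 1 ≤ (n : ℝ) / spread n Ω := (one_le_div hs).2 hsn
  have hT0 : (0 : ℝ) ≤ T.card := by positivity
  refine specNorm_sq_le_of_dual _ (div_nonneg (by linarith) hn'.le) fun u => ?_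
  set x : Ω → ℝ := fun ω => (((ω : Fin n) : ℕ) + 1 : ℝ) / n with hx
  set v : Ω → ℂ := fun ω => u ω * Complex.exp (2 * Real.pi * Complex.I * ((m + 1 : ℝ) * x ω : ℝ))
    with hv
  have hvn : ∀ ω, ‖v ω‖ = ‖u ω‖ := fun ω => by rw [hv, norm_mul, norm_exp_two_pi_I_mul, mul_one]
  have hls := (separatedModOne_of_spread hn Ω).sum_norm_sq_le (div_pos hs hn')
    ((div_le_one hn').2 hsn) T.card v
  rw [inv_div] at hls
  simp only [hvn] at hls
  set g : ℕ → ℝ := fun t => ‖∑ r, v r * Complex.exp (2 * Real.pi * Complex.I * (t * x r))‖ ^ 2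
    with hg
  have hcol : ∀ t : T, ‖∑ r, u r * dftSub n Ω T r t‖ ^ 2 = 1 / n * g ((t : Fin n) - m) := by
    intro t
    have ht := ((hT t).1 t.2).1
    have : ∀ r, u r * dftSub n Ω T r t = (1 / (Real.sqrt n : ℂ)) * (v r *
        Complex.exp (2 * Real.pi * Complex.I * ((((t : Fin n) : ℕ) - m : ℕ) * x r))) := by
      intro r
      rw [hv, mul_assoc, ← Complex.exp_add, dftSub, Matrix.submatrix_apply, dftMatrix,
        mul_left_comm]
      congr 3
      rw [Nat.cast_sub ht, hx]
      push_cast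
      ring
    rw [sum_congr rfl fun r _ => this r, ← mul_sum, norm_mul, mul_pow, norm_div, norm_one,
      Complex.norm_real, Real.norm_of_nonneg (Real.sqrt_nonneg _), div_pow, one_pow,
      Real.sq_sqrt hn'.le]
  have hsum : ∑ t : T, g ((t : Fin n) - m) ≤ ∑ t ∈ range T.card, g t := by
    have hinj : Set.InjOn (fun t : T => ((t : Fin n) : ℕ) - m) (univ : Finset T) := by
      intro a _ b _ hab
      have ha := ((hT a).1 a.2).1
      have hb := ((hT b).1 b.2).1
      simp only at hab
      exact Subtype.ext (Fin.ext (by omega))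
    rw [← sum_image (f := g) hinj]
    refine sum_le_sum_of_subset_of_nonneg ?_ fun _ _ _ => by positivity
    intro k hk
    obtain ⟨t, -, rfl⟩ := mem_image.1 hk
    have ht := (hT t).1 t.2
    rw [mem_range]
    omega
  rw [sum_congr rfl fun t _ => hcol t, ← mul_sum]
  calc 1 / (n : ℝ) * ∑ t : T, g ((t : Fin n) - m)
      ≤ 1 / n * ((T.card - 1 + n / spread n Ω) * ∑ r, ‖u r‖ ^ 2) := by
        gcongr
        exact hsum.trans hls
    _ = (T.card + n / spread n Ω - 1) / n * ∑ r, ‖u r‖ ^ 2 := by ring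

end LargeSieve

/-- **Large sieve inequality.**  If `T = {m+1, …, m+|T|}` is a block of adjacent indices in
`{1, …, n}` and `|Ω| ≥ 2`, then `‖F_{ΩT}‖² ≤ (|T| + n/spread(Ω) − 1)/n`.  In particular, if
`|T| + n/spread(Ω) < n + 1`, then `‖F_{ΩT}‖ < 1`. -/
theorem stmt_7 (n : ℕ) (hn : 0 < n) (T Ω : Finset (Fin n)) (m : ℕ)
    (hT : ∀ t : Fin n, t ∈ T ↔ m ≤ (t : ℕ) ∧ (t : ℕ) < m + T.card)
    (hΩ : 2 ≤ Ω.card) :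
    specNorm (dftSub n Ω T) ^ 2 ≤ ((T.card : ℝ) + (n : ℝ) / (spread n Ω : ℝ) - 1) / n ∧
      ((T.card : ℝ) + (n : ℝ) / (spread n Ω : ℝ) < n + 1 →
        specNorm (dftSub n Ω T) < 1) := by
  have h := LargeSieve.specNorm_dftSub_sq_le n hn T Ω m hT hΩ
  refine ⟨h, fun hlt => ?_⟩
  have hn' : (0 : ℝ) < n := by exact_mod_cast hn
  have h1 : specNorm (dftSub n Ω T) ^ 2 < 1 :=
    h.trans_lt ((div_lt_one hn').2 (by linarith))
  exact lt_of_pow_lt_pow_left₀ 2 zero_le_one (by rwa [one_pow])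
end

section
/- There exists an absolute constant c > 0 such that the following holds for every positive integer n and every s ≥ 1. Suppose T ⊆ {1,…,n} is an arbitrary set and Ω is a uniformly random subset of {1,…,n} of fixed cardinality |Ω|, where |T| log n + |Ω| ≤ c n / s. Then P( ‖F_{ΩT}‖² ≥ 0.5 ) ≤ n^{−s}. -/
attribute [local instance] Classical.propDecidable

/-- The probability that a uniformly random subset `Ω ⊆ {1,…,n}` of fixed cardinality `m`
satisfies the predicate `p`: the number of subsets of cardinality `m` satisfying `p`, divided
by the total number of subsets of cardinality `m`. -/
noncomputable def uniformSetProb (n m : ℕ) (p : Finset (Fin n) → Prop) : ℝ :=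
  (((Finset.powersetCard m (Finset.univ : Finset (Fin n))).filter p).card : ℝ) /
    ((Finset.powersetCard m (Finset.univ : Finset (Fin n))).card : ℝ)

/-- The probability that a pair of independent uniformly random subsets `T, Ω ⊆ {1,…,n}` of
fixed cardinalities `mT` and `mΩ` satisfies the predicate `p`. -/
noncomputable def uniformPairProb (n mT mΩ : ℕ)
    (p : Finset (Fin n) → Finset (Fin n) → Prop) : ℝ :=
  ((((Finset.powersetCard mT (Finset.univ : Finset (Fin n))) ×ˢ
      (Finset.powersetCard mΩ (Finset.univ : Finset (Fin n)))).filter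
        fun q => p q.1 q.2).card : ℝ) /
    (((Finset.powersetCard mT (Finset.univ : Finset (Fin n))).card *
      (Finset.powersetCard mΩ (Finset.univ : Finset (Fin n))).card : ℕ) : ℝ)

open Matrix

theorem pow_le_weighted_pow {b K : ℕ} (hK : K ≠ 0) (hb : b ≤ K) {t : ℝ} (ht : 0 ≤ t) :
    t ^ b ≤ (b / K : ℝ) * t ^ K + (1 - b / K) := by
  have hK' : (0 : ℝ) < K := by positivity
  have hbK : (b / K : ℝ) ≤ 1 := (div_le_one hK').2 (by exact_mod_cast hb)
  have h := Real.geom_mean_le_arith_mean2_weighted (w₁ := (b / K : ℝ)) (w₂ := 1 - b / K)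
    (by positivity) (by linarith) (pow_nonneg ht K) zero_le_one (by ring)
  rw [Real.one_rpow, mul_one, mul_one, ← Real.rpow_natCast t K, ← Real.rpow_mul ht,
    mul_div_cancel₀ _ hK'.ne', Real.rpow_natCast, Real.rpow_natCast] at h
  exact h

/-- Intermediate moments of a nonnegative discrete measure are controlled by the total mass and a
higher moment. -/
theorem moment_le_of_moment_le {ι : Type*} [Fintype ι] {w l : ι → ℝ} (hw : ∀ i, 0 ≤ w i)
    (hl : ∀ i, 0 ≤ l i) {L β : ℝ} (hL : ∑ i, w i = L) (hβ : 0 < β) {K : ℕ} (hK : K ≠ 0)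
    (hKβ : ∑ i, w i * l i ^ K ≤ L * β ^ K) {b : ℕ} (hb : b ≤ K) :
    ∑ i, w i * l i ^ b ≤ L * β ^ b := by
  have hK' : (0 : ℝ) < K := by positivity
  have key : ∀ i, w i * l i ^ b ≤
      β ^ b * ((b / K : ℝ) * (w i * l i ^ K / β ^ K) + (1 - b / K) * w i) := by
    intro i
    have h := pow_le_weighted_pow hK hb (div_nonneg (hl i) hβ.le)
    rw [div_pow, div_pow, div_le_iff₀ (by positivity)] at h
    calc w i * l i ^ b ≤ w i * ((b / K * (l i ^ K / β ^ K) + (1 - b / K)) * β ^ b) :=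
          mul_le_mul_of_nonneg_left h (hw i)
      _ = _ := by ring
  calc ∑ i, w i * l i ^ b
      ≤ ∑ i, β ^ b * ((b / K : ℝ) * (w i * l i ^ K / β ^ K) + (1 - b / K) * w i) :=
        Finset.sum_le_sum fun i _ => key i
    _ = β ^ b * ((b / K : ℝ) * ((∑ i, w i * l i ^ K) / β ^ K) + (1 - b / K) * L) := by
        rw [← Finset.mul_sum, Finset.sum_add_distrib, ← Finset.mul_sum, ← Finset.mul_sum,
          Finset.sum_div, hL]
    _ ≤ β ^ b * ((b / K : ℝ) * L + (1 - b / K) * L) := by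
        have : (∑ i, w i * l i ^ K) / β ^ K ≤ L := (div_le_iff₀ (by positivity)).2 hKβ
        gcongr
    _ = L * β ^ b := by ring

theorem le_mul_add_pow_of_renewal {g h : ℕ → ℝ} (hg : ∀ k, 0 ≤ g k)
    (hh : ∀ k, h k = g k + ∑ i ∈ Finset.range k, h i * g (k - 1 - i)) {L β : ℝ} (hL : 0 ≤ L)
    (hβ : 0 ≤ β) {K : ℕ} (hK : ∀ b ≤ K, g b ≤ L * β ^ b) :
    ∀ k ≤ K, h k ≤ L * (β + L) ^ k := by
  intro k
  induction k using Nat.strong_induction_on with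
  | _ k ih =>
    intro hk
    have hgeom := (Commute.all (β + L) β).geom_sum₂_mul k
    calc h k = g k + ∑ i ∈ Finset.range k, h i * g (k - 1 - i) := hh k
      _ ≤ L * β ^ k + ∑ i ∈ Finset.range k, (L * (β + L) ^ i) * (L * β ^ (k - 1 - i)) := by
          refine add_le_add (hK k hk) (Finset.sum_le_sum fun i hi => ?_)
          have hi' := Finset.mem_range.1 hi
          exact mul_le_mul (ih i hi' (by omega)) (hK _ (by omega)) (hg _) (by positivity)
      _ = L * β ^ k + L * ((∑ i ∈ Finset.range k, (β + L) ^ i * β ^ (k - 1 - i)) *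
            (β + L - β)) := by
          rw [Finset.sum_mul, Finset.mul_sum]
          congr 1
          exact Finset.sum_congr rfl fun i _ => by ring
      _ = L * (β + L) ^ k := by rw [hgeom]; ring

theorem le_three_mul_of_renewal {ι : Type*} [Fintype ι] {w l : ι → ℝ} (hw : ∀ i, 0 ≤ w i)
    (hl : ∀ i, 0 ≤ l i) {h : ℕ → ℝ}
    (hh : ∀ k, h k = ∑ i, w i * l i ^ k +
      ∑ j ∈ Finset.range k, h j * ∑ i, w i * l i ^ (k - 1 - j))
    {L : ℝ} (hL : ∑ i, w i = L) (K : ℕ) :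
    h K ≤ 3 * (∑ i, w i * l i ^ K + L * (K * L) ^ K) := by
  have hg : ∀ k, 0 ≤ ∑ i, w i * l i ^ k := fun k =>
    Finset.sum_nonneg fun i _ => mul_nonneg (hw i) (pow_nonneg (hl i) k)
  have hL0 : 0 ≤ L := hL ▸ Finset.sum_nonneg fun i _ => hw i
  rcases Nat.eq_zero_or_pos K with rfl | hK
  · have := hh 0
    simp only [pow_zero, mul_one, hL, Finset.range_zero, Finset.sum_empty, add_zero] at this ⊢
    linarith
  rcases hL0.eq_or_lt with h0 | hLpos
  · have hw0 : ∀ i, w i = 0 := fun i =>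
      (Finset.sum_eq_zero_iff_of_nonneg fun i _ => hw i).1 (hL.trans h0.symm) i (Finset.mem_univ i)
    have := hh K
    simp only [hw0, zero_mul, Finset.sum_const_zero, mul_zero, add_zero] at this
    simp [this, hw0, ← h0]
  have hK' : (0 : ℝ) < K := by exact_mod_cast hK
  set G := ∑ i, w i * l i ^ K
  obtain ⟨β, hβ, hβK⟩ : ∃ β : ℝ, 0 < β ∧ β ^ K = G / L + (K * L) ^ K := by
    have hpos : 0 < G / L + (K * L) ^ K := by
      have := hg K
      positivity
    exact ⟨_, Real.rpow_pos_of_pos hpos _, Real.rpow_inv_natCast_pow hpos.le hK.ne'⟩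
  have hβL : K * L ≤ β := by
    refine le_of_pow_le_pow_left₀ hK.ne' hβ.le ?_
    rw [hβK]
    have := div_nonneg (hg K) hL0
    linarith
  have hLβ : L * β ^ K = G + L * (K * L) ^ K := by
    rw [hβK]; field_simp
  have hb : ∀ b ≤ K, ∑ i, w i * l i ^ b ≤ L * β ^ b := fun b hb =>
    moment_le_of_moment_le hw hl hL hβ hK.ne'
      (by rw [hLβ]; exact le_add_of_nonneg_right (by positivity)) hb
  have h1 := le_mul_add_pow_of_renewal hg hh hL0 hβ.le hb K le_rfl
  have h2 : (β + L) ^ K ≤ 3 * β ^ K := by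
    have h3 : β + L ≤ β * Real.exp (1 / K) := by
      have := Real.add_one_le_exp (1 / K : ℝ)
      calc β + L ≤ β + β / K := by
            gcongr
            rw [le_div_iff₀ hK']; linarith
        _ = β * (1 / K + 1) := by ring
        _ ≤ _ := by gcongr
    calc (β + L) ^ K ≤ (β * Real.exp (1 / K)) ^ K := by gcongr
      _ = Real.exp 1 * β ^ K := by
          rw [mul_pow, ← Real.exp_nat_mul, mul_one_div_cancel hK'.ne', mul_comm]
      _ ≤ 3 * β ^ K := by
          have := Real.exp_one_lt_three
          gcongr
  calc h K ≤ L * (β + L) ^ K := h1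
    _ ≤ L * (3 * β ^ K) := by gcongr
    _ = 3 * (L * β ^ K) := by ring
    _ = _ := by rw [hLβ]

section

open scoped ComplexOrder

theorem Matrix.PosSemidef.exists_pow_eq_unitary_diagonal {ι : Type*} [Fintype ι] [DecidableEq ι]
    {B : Matrix ι ι ℂ} (hB : B.PosSemidef) :
    ∃ U ∈ unitary (Matrix ι ι ℂ), ∃ l : ι → ℝ, (∀ i, 0 ≤ l i) ∧
      ∀ k : ℕ, B ^ k = U * diagonal (fun i => ((l i ^ k : ℝ) : ℂ)) * star U := by
  refine ⟨hB.isHermitian.eigenvectorUnitary, hB.isHermitian.eigenvectorUnitary.2,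
    hB.isHermitian.eigenvalues, hB.eigenvalues_nonneg, fun k => ?_⟩
  conv_lhs => rw [hB.isHermitian.spectral_theorem, ← map_pow, diagonal_pow,
    Unitary.conjStarAlgAut_apply]
  congr 3
  ext i
  simp

theorem Matrix.PosSemidef.exists_quadForm_pow_eq_sum {ι : Type*} [Fintype ι] [DecidableEq ι]
    {B : Matrix ι ι ℂ} (hB : B.PosSemidef) (x : ι → ℂ) :
    ∃ w l : ι → ℝ, (∀ i, 0 ≤ w i) ∧ (∀ i, 0 ≤ l i) ∧
      ∀ k : ℕ, star x ⬝ᵥ (B ^ k *ᵥ x) = ((∑ i, w i * l i ^ k : ℝ) : ℂ) := by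
  obtain ⟨U, -, l, hl, hU⟩ := hB.exists_pow_eq_unitary_diagonal
  refine ⟨fun i => ‖(star U *ᵥ x) i‖ ^ 2, l, fun i => by positivity, hl, fun k => ?_⟩
  have hstar : star x ᵥ* U = star (star U *ᵥ x) := by
    rw [star_mulVec, ← star_eq_conjTranspose, star_star]
  rw [hU, mul_assoc, ← mulVec_mulVec, ← mulVec_mulVec, dotProduct_mulVec, hstar, dotProduct]
  push_cast
  refine Finset.sum_congr rfl fun i _ => ?_
  rw [mulVec_diagonal, ← Complex.conj_mul']
  simp only [Pi.star_apply, RCLike.star_def]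
  ring

theorem Matrix.PosSemidef.pow_le_trace_pow_of_le_norm {ι : Type*} [Fintype ι] [DecidableEq ι]
    {B : Matrix ι ι ℂ} (hB : B.PosSemidef) {r : ℝ} (hr : 0 < r)
    (h : r ≤ specNorm B) (K : ℕ) :
    r ^ K ≤ (B ^ K).trace.re := by
  obtain ⟨U, hU, l, hl, hpow⟩ := hB.exists_pow_eq_unitary_diagonal
  have htr : (B ^ K).trace.re = ∑ i, l i ^ K := by
    rw [hpow, trace_mul_comm, ← mul_assoc, (Unitary.mem_iff.1 hU).1, one_mul, trace_diagonal,
      ← Complex.ofReal_sum, Complex.ofReal_re]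
  obtain ⟨i, hi⟩ : ∃ i, r ≤ l i := by
    by_contra! hlt
    open scoped Matrix.Norms.L2Operator in
    have hnorm : specNorm B = ‖(fun i => ((l i ^ 1 : ℝ) : ℂ))‖ := by
      change ‖B‖ = _
      rw [← pow_one B, hpow, CStarRing.norm_mul_mem_unitary _ (Unitary.star_mem hU),
        CStarRing.norm_mem_unitary_mul _ hU, l2_opNorm_diagonal]
    rw [hnorm] at h
    refine h.not_gt ((pi_norm_lt_iff hr).2 fun i => ?_)
    simpa [abs_of_nonneg (hl i)] using hlt i
  rw [htr]
  exact (pow_le_pow_left₀ hr.le hi K).trans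
    (Finset.single_le_sum (f := fun i => l i ^ K) (fun j _ => pow_nonneg (hl j) K)
      (Finset.mem_univ i))

theorem add_vecMulVec_pow_mulVec {ι R : Type*} [Fintype ι] [DecidableEq ι] [CommRing R]
    (B : Matrix ι ι R) (x y : ι → R) (k : ℕ) :
    (B + vecMulVec x y) ^ k *ᵥ x = B ^ k *ᵥ x + ∑ i ∈ Finset.range k,
      (y ⬝ᵥ ((B + vecMulVec x y) ^ i *ᵥ x)) • (B ^ (k - 1 - i) *ᵥ x) := by
  induction k with
  | zero => simp
  | succ k ih =>
    rw [Finset.sum_range_succ, pow_succ', ← mulVec_mulVec, add_mulVec, vecMulVec_mulVec]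
    conv_lhs => rw [ih]
    rw [mulVec_add, mulVec_mulVec, ← pow_succ', mulVec_sum, ← ih, add_assoc]
    congr 2
    · refine Finset.sum_congr rfl fun i hi => ?_
      have hi' := Finset.mem_range.1 hi
      rw [mulVec_smul, mulVec_mulVec, ← pow_succ', show k - 1 - i + 1 = k + 1 - 1 - i by omega]
    · simp

theorem quadForm_add_vecMulVec_pow_le {ι : Type*} [Fintype ι] [DecidableEq ι]
    {B : Matrix ι ι ℂ} (hB : B.PosSemidef) {x : ι → ℂ} {L : ℝ} (hx : star x ⬝ᵥ x = L) (K : ℕ) :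
    (star x ⬝ᵥ ((B + vecMulVec x (star x)) ^ K *ᵥ x)).re ≤
      3 * ((star x ⬝ᵥ (B ^ K *ᵥ x)).re + L * (K * L) ^ K) := by
  obtain ⟨w, l, hw, hl, hg⟩ := hB.exists_quadForm_pow_eq_sum x
  obtain ⟨w', l', -, -, hh⟩ :=
    (hB.add (posSemidef_vecMulVec_self_star x)).exists_quadForm_pow_eq_sum x
  have hL : ∑ i, w i = L := by
    have h0 := hg 0
    rw [pow_zero, one_mulVec, hx] at h0
    simpa using (Complex.ofReal_injective h0).symm
  have hrec : ∀ k, (∑ i, w' i * l' i ^ k) = ∑ i, w i * l i ^ k +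
      ∑ j ∈ Finset.range k, (∑ i, w' i * l' i ^ j) * ∑ i, w i * l i ^ (k - 1 - j) := by
    intro k
    apply Complex.ofReal_injective
    rw [Complex.ofReal_add, Complex.ofReal_sum (Finset.range k), ← hg, ← hh,
      add_vecMulVec_pow_mulVec, dotProduct_add, dotProduct_sum]
    congr 1
    refine Finset.sum_congr rfl fun i _ => ?_
    rw [dotProduct_smul, hg, hh, smul_eq_mul, Complex.ofReal_mul]
  rw [hg, hh, Complex.ofReal_re, Complex.ofReal_re]
  exact le_three_mul_of_renewal hw hl hrec hL K

/-- The partial frame operator `∑_{j ∈ Ω} x_j x_j^*`. -/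
noncomputable def frameOp {ι κ : Type*} (x : κ → ι → ℂ) (Ω : Finset κ) : Matrix ι ι ℂ :=
  ∑ j ∈ Ω, vecMulVec (x j) (star (x j))

theorem frameOp_posSemidef {ι κ : Type*} [Fintype ι] (x : κ → ι → ℂ) (Ω : Finset κ) :
    (frameOp x Ω).PosSemidef :=
  posSemidef_sum _ fun j _ => posSemidef_vecMulVec_self_star (x j)

theorem trace_mul_frameOp {ι κ : Type*} [Fintype ι] (x : κ → ι → ℂ) (Ω : Finset κ)
    (M : Matrix ι ι ℂ) :
    (M * frameOp x Ω).trace = ∑ j ∈ Ω, star (x j) ⬝ᵥ (M *ᵥ x j) := by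
  simp only [frameOp, Matrix.mul_sum, trace_sum, mul_vecMulVec, trace_vecMulVec, dotProduct_comm]

theorem sum_powersetCard_succ_sum_erase {κ M : Type*} [Fintype κ] [DecidableEq κ]
    [AddCommMonoid M] (m : ℕ) (f : Finset κ → κ → M) :
    ∑ Ω ∈ Finset.powersetCard (m + 1) Finset.univ, ∑ j ∈ Ω, f (Ω.erase j) j =
      ∑ Ω ∈ Finset.powersetCard m Finset.univ, ∑ j ∈ Ωᶜ, f Ω j := by
  rw [Finset.sum_sigma', Finset.sum_sigma']
  refine Finset.sum_bij' (fun p _ => ⟨p.1.erase p.2, p.2⟩) (fun p _ => ⟨insert p.2 p.1, p.2⟩)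
    ?_ ?_ ?_ ?_ ?_
  · rintro ⟨Ω, j⟩ h
    simp only [Finset.mem_sigma, Finset.mem_powersetCard_univ, Finset.mem_compl] at h ⊢
    exact ⟨by rw [Finset.card_erase_of_mem h.2, h.1]; rfl, Finset.notMem_erase _ _⟩
  · rintro ⟨Ω, j⟩ h
    simp only [Finset.mem_sigma, Finset.mem_powersetCard_univ, Finset.mem_compl] at h ⊢
    exact ⟨by rw [Finset.card_insert_of_notMem h.2, h.1], Finset.mem_insert_self _ _⟩
  · rintro ⟨Ω, j⟩ h
    simp only [Finset.mem_sigma] at h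
    simp [Finset.insert_erase h.2]
  · rintro ⟨Ω, j⟩ h
    simp only [Finset.mem_sigma, Finset.mem_compl] at h
    simp [Finset.erase_insert h.2]
  · rintro ⟨Ω, j⟩ h
    rfl

section Moments

variable {ι κ : Type*} [Fintype ι] [DecidableEq ι] [Fintype κ] [DecidableEq κ]

theorem sum_trace_frameOp_pow_succ_le {x : κ → ι → ℂ} {L : ℝ} (hx : ∀ j, star (x j) ⬝ᵥ x j = L)
    (hone : frameOp x Finset.univ = 1) (hL : 0 ≤ L) (m k : ℕ) :
    ∑ Ω ∈ Finset.powersetCard (m + 1) Finset.univ, (frameOp x Ω ^ (k + 1)).trace.re ≤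
      3 * (∑ Ω ∈ Finset.powersetCard m Finset.univ, (frameOp x Ω ^ k).trace.re +
        (Fintype.card κ).choose m * (Fintype.card κ * L * (k * L) ^ k)) := by
  have hpos : ∀ (Ω : Finset κ) (j : κ), 0 ≤ (star (x j) ⬝ᵥ (frameOp x Ω ^ k *ᵥ x j)).re :=
    fun Ω j => by
      obtain ⟨w, l, hw, hl, hg⟩ := (frameOp_posSemidef x Ω).exists_quadForm_pow_eq_sum (x j)
      rw [hg, Complex.ofReal_re]
      exact Finset.sum_nonneg fun i _ => mul_nonneg (hw i) (pow_nonneg (hl i) k)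
  have hE : 0 ≤ L * (k * L) ^ k := by positivity
  calc ∑ Ω ∈ Finset.powersetCard (m + 1) Finset.univ, (frameOp x Ω ^ (k + 1)).trace.re
      = ∑ Ω ∈ Finset.powersetCard (m + 1) Finset.univ, ∑ j ∈ Ω,
          (star (x j) ⬝ᵥ ((frameOp x (Ω.erase j) + vecMulVec (x j) (star (x j))) ^ k *ᵥ x j)).re := by
        refine Finset.sum_congr rfl fun Ω _ => ?_
        rw [pow_succ, trace_mul_frameOp, Complex.re_sum]
        refine Finset.sum_congr rfl fun j hj => ?_
        rw [frameOp, frameOp, Finset.sum_erase_add _ _ hj]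
    _ = ∑ Ω ∈ Finset.powersetCard m Finset.univ, ∑ j ∈ Ωᶜ,
          (star (x j) ⬝ᵥ ((frameOp x Ω + vecMulVec (x j) (star (x j))) ^ k *ᵥ x j)).re :=
        sum_powersetCard_succ_sum_erase m fun Ω j =>
          (star (x j) ⬝ᵥ ((frameOp x Ω + vecMulVec (x j) (star (x j))) ^ k *ᵥ x j)).re
    _ ≤ ∑ Ω ∈ Finset.powersetCard m Finset.univ,
          3 * ((frameOp x Ω ^ k).trace.re + Fintype.card κ * (L * (k * L) ^ k)) := by
        refine Finset.sum_le_sum fun Ω _ => ?_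
        calc _ ≤ ∑ j ∈ Ωᶜ, 3 * ((star (x j) ⬝ᵥ (frameOp x Ω ^ k *ᵥ x j)).re + L * (k * L) ^ k) :=
              Finset.sum_le_sum fun j _ =>
                quadForm_add_vecMulVec_pow_le (frameOp_posSemidef x Ω) (hx j) k
          _ ≤ ∑ j, 3 * ((star (x j) ⬝ᵥ (frameOp x Ω ^ k *ᵥ x j)).re + L * (k * L) ^ k) :=
              Finset.sum_le_sum_of_subset_of_nonneg (Finset.subset_univ _) fun j _ _ => by
                have := hpos Ω j
                positivity
          _ = _ := by
              rw [← Finset.mul_sum, Finset.sum_add_distrib, ← Complex.re_sum, ← trace_mul_frameOp,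
                hone, mul_one, Finset.sum_const, Finset.card_univ, nsmul_eq_mul]
    _ = _ := by
        rw [← Finset.mul_sum, Finset.sum_add_distrib, Finset.sum_const, Finset.card_powersetCard,
          Finset.card_univ, nsmul_eq_mul, mul_assoc]

theorem sum_trace_frameOp_pow_le {x : κ → ι → ℂ} {L : ℝ} (hx : ∀ j, star (x j) ⬝ᵥ x j = L)
    (hone : frameOp x Finset.univ = 1) (hL : 0 ≤ L)
    (hcard : Fintype.card κ * L = Fintype.card ι) {ρ : ℝ} (hρ : 0 ≤ ρ) {M K : ℕ}
    (hM : 3 * (M : ℝ) ≤ ρ * (Fintype.card κ - M)) (hMκ : M ≤ Fintype.card κ) (hK : K * L ≤ ρ) :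
    ∀ k ≤ K, ∀ m ≤ M,
      ∑ Ω ∈ Finset.powersetCard m Finset.univ, (frameOp x Ω ^ k).trace.re ≤
        (Fintype.card κ).choose m * (Fintype.card ι * (2 * ρ) ^ k) := by
  intro k
  induction k with
  | zero =>
    intro _ m _
    simp
  | succ k ih =>
    intro hk m hm
    rcases m with _ | m
    · simp only [Finset.powersetCard_zero, Finset.sum_singleton, frameOp, Finset.sum_empty]
      rw [zero_pow (Nat.succ_ne_zero k), trace_zero, Complex.zero_re]
      positivity
    have hkL : k * L ≤ ρ := le_trans (by gcongr; omega) hK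
    have hch : 3 * ((Fintype.card κ).choose m : ℝ) ≤ ρ * (Fintype.card κ).choose (m + 1) := by
      have hpas : ((Fintype.card κ).choose (m + 1) : ℝ) * (m + 1) =
          (Fintype.card κ).choose m * (Fintype.card κ - m) := by
        have := Nat.choose_succ_right_eq (Fintype.card κ) m
        rw [← Nat.cast_sub (by omega)]
        exact_mod_cast this
      have hm1 : (m : ℝ) + 1 ≤ M := by exact_mod_cast hm
      have hMκ' : (M : ℝ) ≤ Fintype.card κ := by exact_mod_cast hMκ
      have hpos : (0 : ℝ) < Fintype.card κ - m := by linarith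
      refine le_of_mul_le_mul_right ?_ hpos
      have h3 : 3 * ((m : ℝ) + 1) ≤ ρ * (Fintype.card κ - m) :=
        calc 3 * ((m : ℝ) + 1) ≤ 3 * M := by linarith
          _ ≤ _ := hM
          _ ≤ _ := by gcongr; linarith
      calc 3 * ((Fintype.card κ).choose m : ℝ) * (Fintype.card κ - m)
          = (Fintype.card κ).choose (m + 1) * (3 * ((m : ℝ) + 1)) := by linear_combination -3 * hpas
        _ ≤ (Fintype.card κ).choose (m + 1) * (ρ * (Fintype.card κ - m)) := by gcongr
        _ = _ := by ring
    calc _ ≤ 3 * (∑ Ω ∈ Finset.powersetCard m Finset.univ, (frameOp x Ω ^ k).trace.re +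
        (Fintype.card κ).choose m * (Fintype.card κ * L * (k * L) ^ k)) :=
          sum_trace_frameOp_pow_succ_le hx hone hL m k
      _ ≤ 3 * ((Fintype.card κ).choose m * (Fintype.card ι * (2 * ρ) ^ k) +
        (Fintype.card κ).choose m * (Fintype.card ι * (2 * ρ) ^ k)) := by
          have h1 := ih (by omega) m (by omega)
          have h2 : (k * L) ^ k ≤ (2 * ρ) ^ k :=
            pow_le_pow_left₀ (by positivity) (by linarith) k
          rw [hcard]
          exact mul_le_mul_of_nonneg_left (add_le_add h1 (mul_le_mul_of_nonneg_left
            (mul_le_mul_of_nonneg_left h2 (Nat.cast_nonneg _)) (Nat.cast_nonneg _))) (by norm_num)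
      _ = 3 * (Fintype.card κ).choose m * (2 * (Fintype.card ι * (2 * ρ) ^ k)) := by ring
      _ ≤ ρ * (Fintype.card κ).choose (m + 1) * (2 * (Fintype.card ι * (2 * ρ) ^ k)) := by
          gcongr
      _ = _ := by ring

theorem card_filter_le_of_le_norm_frameOp {x : κ → ι → ℂ} {L : ℝ}
    (hx : ∀ j, star (x j) ⬝ᵥ x j = L)
    (hone : frameOp x Finset.univ = 1) (hL : 0 ≤ L)
    (hcard : Fintype.card κ * L = Fintype.card ι) {ρ : ℝ} (hρ : 0 ≤ ρ) {M K : ℕ}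
    (hM : 3 * (M : ℝ) ≤ ρ * (Fintype.card κ - M)) (hMκ : M ≤ Fintype.card κ) (hK : K * L ≤ ρ)
    (p : Finset κ → Prop) [DecidablePred p] (hp : ∀ Ω, p Ω → 1 / 2 ≤ specNorm (frameOp x Ω)) :
    (((Finset.powersetCard M Finset.univ).filter p).card : ℝ) ≤
      (Fintype.card κ).choose M * (Fintype.card ι * (4 * ρ) ^ K) := by
  have h := sum_trace_frameOp_pow_le hx hone hL hcard hρ hM hMκ hK K le_rfl M le_rfl
  have hnn : ∀ Ω, 0 ≤ (frameOp x Ω ^ K).trace.re := fun Ω =>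
    (Complex.le_def.1 ((frameOp_posSemidef x Ω).pow K).trace_nonneg).1
  have h2 : (((Finset.powersetCard M Finset.univ).filter p).card : ℝ) * (1 / 2) ^ K ≤
      ∑ Ω ∈ Finset.powersetCard M Finset.univ, (frameOp x Ω ^ K).trace.re := by
    rw [← nsmul_eq_mul, ← Finset.sum_const]
    calc _ ≤ ∑ Ω ∈ (Finset.powersetCard M Finset.univ).filter p, (frameOp x Ω ^ K).trace.re :=
          Finset.sum_le_sum fun Ω hΩ => (frameOp_posSemidef x Ω).pow_le_trace_pow_of_le_norm
            (by norm_num) (hp Ω (Finset.mem_filter.1 hΩ).2) K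
      _ ≤ _ := Finset.sum_le_sum_of_subset_of_nonneg (Finset.filter_subset _ _) fun Ω _ _ => hnn Ω
  calc (((Finset.powersetCard M Finset.univ).filter p).card : ℝ)
      = ((Finset.powersetCard M Finset.univ).filter p).card * (1 / 2) ^ K * 2 ^ K := by
        rw [mul_assoc, ← mul_pow]; norm_num
    _ ≤ (Fintype.card κ).choose M * (Fintype.card ι * (2 * ρ) ^ K) * 2 ^ K :=
        mul_le_mul_of_nonneg_right (h2.trans h) (by positivity)
    _ = _ := by
        rw [mul_assoc, mul_assoc, ← mul_pow]; ring_nf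

end Moments

end

theorem specNorm_conjTranspose_mul_self {α β : Type*} [Fintype α] [Fintype β] [DecidableEq α]
    [DecidableEq β] (A : Matrix α β ℂ) : specNorm (Aᴴ * A) = specNorm A ^ 2 := by
  open scoped Matrix.Norms.L2Operator in
  exact (l2_opNorm_conjTranspose_mul_self A).trans (sq _).symm

theorem star_dftMatrix_mul_dftMatrix {n : ℕ} (j t u : Fin n) :
    star (dftMatrix n j t) * dftMatrix n j u =
      1 / n * Complex.exp (2 * Real.pi * Complex.I * ((u : ℂ) - t) / n) ^ ((j : ℕ) + 1) := by
  have hsq : (1 / (Real.sqrt n : ℂ)) * (1 / (Real.sqrt n : ℂ)) = 1 / n := by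
    rw [div_mul_div_comm, ← Complex.ofReal_mul, Real.mul_self_sqrt (Nat.cast_nonneg n)]
    simp
  rw [← Complex.exp_nat_mul, ← hsq]
  simp only [dftMatrix, RCLike.star_def, map_mul, ← Complex.exp_conj, map_div₀, map_add, map_one,
    Complex.conj_ofReal, Complex.conj_I, map_natCast, map_ofNat]
  rw [mul_mul_mul_comm, ← Complex.exp_add]
  congr 2
  push_cast
  ring

theorem sum_star_dftMatrix_mul_dftMatrix {n : ℕ} (t u : Fin n) :
    ∑ j, star (dftMatrix n j t) * dftMatrix n j u = if t = u then 1 else 0 := by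
  have hn : (n : ℂ) ≠ 0 := Nat.cast_ne_zero.2 (Fin.pos t).ne'
  simp only [star_dftMatrix_mul_dftMatrix]
  split_ifs with h
  · subst h
    simp [hn]
  · set ζ := Complex.exp (2 * Real.pi * Complex.I * ((u : ℂ) - t) / n) with hζ
    have hζn : ζ ^ n = 1 := by
      rw [hζ, ← Complex.exp_nat_mul, Complex.exp_eq_one_iff]
      refine ⟨(u : ℤ) - t, ?_⟩
      push_cast
      field_simp
    have hζ1 : ζ ≠ 1 := by
      rw [hζ, Ne, Complex.exp_eq_one_iff]
      rintro ⟨z, hz⟩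
      have h2 : (2 * Real.pi * Complex.I : ℂ) ≠ 0 := Complex.two_pi_I_ne_zero
      have h3 : ((u : ℂ) - t) = z * n := by
        rw [div_eq_iff hn] at hz
        refine mul_left_cancel₀ h2 ?_
        rw [hz]; ring
      have h4 : (u : ℤ) - t = z * n := by exact_mod_cast h3
      have h5 : (n : ℤ) ∣ (u : ℤ) - t := ⟨z, by rw [h4, mul_comm]⟩
      have h6 : |(u : ℤ) - t| < n := by
        have := t.2
        have := u.2
        rw [abs_lt]; omega
      have h7 := Int.eq_zero_of_abs_lt_dvd h5 h6
      exact h (Fin.ext (by omega))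
    have hgeom : ∑ i ∈ Finset.range n, ζ ^ i = 0 := by
      rw [geom_sum_eq hζ1, hζn, sub_self, zero_div]
    rw [← Finset.mul_sum, Fin.sum_univ_eq_sum_range (fun i => ζ ^ (i + 1)) n]
    simp only [pow_succ]
    rw [← Finset.sum_mul, hgeom, zero_mul, mul_zero]

/-- The conjugated rows of the DFT matrix, restricted to the columns in `T`. -/
noncomputable def dftRow (n : ℕ) (T : Finset (Fin n)) (j : Fin n) : T → ℂ :=
  fun t => star (dftMatrix n j t)

theorem star_dftRow_dotProduct_self (n : ℕ) (T : Finset (Fin n)) (j : Fin n) :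
    star (dftRow n T j) ⬝ᵥ dftRow n T j = ((T.card / n : ℝ) : ℂ) := by
  have h : ∀ t : T, star (dftRow n T j) t * dftRow n T j t = 1 / n := fun t => by
    rw [mul_comm, Pi.star_apply, dftRow, star_star, star_dftMatrix_mul_dftMatrix]
    simp
  rw [dotProduct, Finset.sum_congr rfl fun t _ => h t]
  simp [div_eq_mul_inv]

theorem frameOp_dftRow_univ (n : ℕ) (T : Finset (Fin n)) [DecidableEq T] :
    frameOp (dftRow n T) Finset.univ = 1 := by
  ext t u
  simp only [frameOp, Matrix.sum_apply, vecMulVec_apply, dftRow, Pi.star_apply, star_star,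
    sum_star_dftMatrix_mul_dftMatrix, Matrix.one_apply, Subtype.ext_iff]

theorem frameOp_dftRow (n : ℕ) (Ω T : Finset (Fin n)) :
    frameOp (dftRow n T) Ω = (dftSub n Ω T)ᴴ * dftSub n Ω T := by
  ext t u
  simp only [frameOp, Matrix.sum_apply, vecMulVec_apply, dftRow, Pi.star_apply, star_star,
    Matrix.mul_apply, conjTranspose_apply, dftSub, submatrix_apply]
  exact (Finset.sum_coe_sort Ω fun j => star (dftMatrix n j t) * dftMatrix n j u).symm

/-- There is an absolute constant `c > 0` such that for every positive integer `n`, every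
`s ≥ 1`, every set `T` and a uniformly random set `Ω` with `|T| log n + |Ω| ≤ c n / s`, one has
`P(‖F_{ΩT}‖² ≥ 0.5) ≤ n^{−s}`. -/
theorem stmt_9 :
    ∃ c : ℝ, 0 < c ∧
      ∀ n : ℕ, 0 < n → ∀ s : ℝ, 1 ≤ s → ∀ T : Finset (Fin n), ∀ mΩ : ℕ,
        (T.card : ℝ) * Real.log n + mΩ ≤ c * n / s →
        uniformSetProb n mΩ (fun Ω => (0.5 : ℝ) ≤ specNorm (dftSub n Ω T) ^ 2) ≤
          (n : ℝ) ^ (-s) := by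
  refine ⟨1 / 100, by norm_num, fun n hn s hs T m hm => ?_⟩
  rcases Nat.lt_or_ge n 2 with hn2 | hn2
  · obtain rfl : n = 1 := by omega
    rw [Nat.cast_one, Real.one_rpow]
    exact div_le_one_of_le₀ (Nat.cast_le.2 (Finset.card_filter_le _ _)) (Nat.cast_nonneg _)
  have hn0 : (0 : ℝ) < n := by exact_mod_cast hn
  have hlog : 1 / 2 ≤ Real.log n := by
    have h1 : Real.log 2 ≤ Real.log n := Real.log_le_log (by norm_num) (by exact_mod_cast hn2)
    have := Real.log_two_gt_d9
    linarith
  have hsn : 1 / 100 * n / s ≤ (1 / 100 * n : ℝ) := div_le_self (by positivity) hs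
  have hTlog : 0 ≤ (T.card : ℝ) * Real.log n := by positivity
  have hmn : (m : ℝ) ≤ 1 / 100 * n := by linarith
  set K := ⌈2 * s * Real.log n⌉₊
  have hKge : 2 * s * Real.log n ≤ K := Nat.le_ceil _
  have hKle : (K : ℝ) ≤ 4 * s * Real.log n := by
    have h1 := Nat.ceil_lt_add_one (a := 2 * s * Real.log n) (by positivity)
    have h2 : 1 * (1 / 2) ≤ s * Real.log n := by gcongr
    linarith
  have hKL : (K : ℝ) * (T.card / n) ≤ 1 / 12 := by
    have h1 : s * ((T.card : ℝ) * Real.log n) ≤ 1 / 100 * n := by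
      have h2 : (T.card : ℝ) * Real.log n ≤ 1 / 100 * n / s := by
        have : (0 : ℝ) ≤ m := Nat.cast_nonneg m
        linarith
      rw [le_div_iff₀ (by linarith)] at h2
      linarith
    rw [← mul_div_assoc, div_le_iff₀ hn0]
    calc (K : ℝ) * T.card ≤ 4 * s * Real.log n * T.card := by gcongr
      _ = 4 * (s * (T.card * Real.log n)) := by ring
      _ ≤ 1 / 12 * n := by linarith
  have hcount := card_filter_le_of_le_norm_frameOp (x := dftRow n T) (ρ := 1 / 12) (M := m)
    (star_dftRow_dotProduct_self n T) (frameOp_dftRow_univ n T) (by positivity)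
    (by rw [Fintype.card_fin, Fintype.card_coe]; field_simp) (by norm_num)
    (by rw [Fintype.card_fin]; linarith)
    (by rw [Fintype.card_fin]; exact_mod_cast (show (m : ℝ) ≤ n by linarith)) hKL
    (fun Ω => (0.5 : ℝ) ≤ specNorm (dftSub n Ω T) ^ 2)
    (fun Ω h => by
      rw [frameOp_dftRow, specNorm_conjTranspose_mul_self]
      norm_num at h ⊢
      exact h)
  rw [Fintype.card_fin, Fintype.card_coe] at hcount
  have hfin : (T.card : ℝ) * (4 * (1 / 12)) ^ K ≤ (n : ℝ) ^ (-s) := by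
    have hT : (T.card : ℝ) ≤ n := by exact_mod_cast (Finset.card_le_univ T).trans_eq (by simp)
    have hexp : (4 * (1 / 12) : ℝ) ^ K ≤ (n : ℝ) ^ (-(2 * s)) := by
      calc (4 * (1 / 12) : ℝ) ^ K ≤ Real.exp (-1) ^ K := by
            have := Real.exp_one_lt_three
            gcongr
            rw [Real.exp_neg, show (4 * (1 / 12) : ℝ) = 3⁻¹ by norm_num]
            gcongr
        _ = Real.exp (-K) := by rw [← Real.exp_nat_mul]; ring_nf
        _ ≤ Real.exp (Real.log n * -(2 * s)) := by
            gcongr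
            linarith
        _ = _ := (Real.rpow_def_of_pos hn0 _).symm
    calc (T.card : ℝ) * (4 * (1 / 12)) ^ K ≤ n * (n : ℝ) ^ (-(2 * s)) := by gcongr
      _ = (n : ℝ) ^ (1 + -(2 * s)) := by rw [Real.rpow_add hn0, Real.rpow_one]
      _ ≤ (n : ℝ) ^ (-s) :=
          Real.rpow_le_rpow_of_exponent_le (by exact_mod_cast hn) (by linarith)
  rw [uniformSetProb, Finset.card_powersetCard, Finset.card_univ, Fintype.card_fin]
  refine div_le_of_le_mul₀ (Nat.cast_nonneg _) (by positivity) ?_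
  rw [mul_comm]
  exact hcount.trans (by gcongr)
end
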